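/- Let n ≥ 1, 0 < λ ≤ Λ, s₀ ∈ (0,1) and s ∈ [s₀,1). Define ρ₁(x) = dist(x, ℝⁿ∖B₁)^s and ρ₂(x) = dist(x, ℝⁿ∖B₁)^{3s/2}, where B₁ is the open unit ball. Then there exist constants c > 0 and C > 0 depending only on n, s₀, λ and Λ such that for every x ∈ B₁∖B_{1/2} (where ρ₁ and ρ₂ are C² and the Pucci operator is evaluated pointwise): 0 ≥ 𝓜⁻[ρ₁](x) ≥ −C(1 + (1−s)|log(1−|x|)|), and 𝓜⁻[ρ₂](x) ≥ c(1−|x|)^{−s/2} − C. -/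

import Mathlib

open MeasureTheory Metric Set Filter RealInnerProductSpace

noncomputable section

/-- Euclidean space ℝⁿ. -/
abbrev Eu (n : ℕ) := EuclideanSpace ℝ (Fin n)

/-- A kernel `μ` in the class `𝓛_*`: measurable, with values in `[λ, Λ]` on the unit
sphere, and even. -/
def IsAdmissibleKernel (n : ℕ) (lam Lam : ℝ) (μ : Eu n → ℝ) : Prop :=
  Measurable μ ∧ (∀ θ : Eu n, ‖θ‖ = 1 → μ θ ∈ Set.Icc lam Lam) ∧ ∀ θ : Eu n, μ (-θ) = μ θ

/-- The integrand `(u(x+y) + u(x−y) − 2u(x)) μ(y/|y|) |y|^{−(n+2s)}`. -/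
def kernIntegrand (n : ℕ) (s : ℝ) (μ u : Eu n → ℝ) (x y : Eu n) : ℝ :=
  (u (x + y) + u (x - y) - 2 * u x) * μ (‖y‖⁻¹ • y) / ‖y‖ ^ ((n : ℝ) + 2 * s)

/-- The linear nonlocal operator `L_μ u(x)`. -/
def Lop (n : ℕ) (s : ℝ) (μ u : Eu n → ℝ) (x : Eu n) : ℝ :=
  (1 - s) * ∫ y, kernIntegrand n s μ u x y

/-- The Pucci extremal operator `𝓜⁺`. -/
def PucciSup (n : ℕ) (s lam Lam : ℝ) (u : Eu n → ℝ) (x : Eu n) : ℝ :=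
  ⨆ μ : {μ : Eu n → ℝ // IsAdmissibleKernel n lam Lam μ}, Lop n s μ.1 u x

/-- The Pucci extremal operator `𝓜⁻`. -/
def PucciInf (n : ℕ) (s lam Lam : ℝ) (u : Eu n → ℝ) (x : Eu n) : ℝ :=
  ⨅ μ : {μ : Eu n → ℝ // IsAdmissibleKernel n lam Lam μ}, Lop n s μ.1 u x

/-- Membership in `L¹_s(ℝⁿ)`. -/
def MemL1s (n : ℕ) (s : ℝ) (u : Eu n → ℝ) : Prop :=
  Integrable (fun x : Eu n => |u x| / (1 + ‖x‖ ^ ((n : ℝ) + 2 * s)))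

/-- The weighted norm `‖u‖_{L¹_s(ℝⁿ)}`. -/
def L1sNorm (n : ℕ) (s : ℝ) (u : Eu n → ℝ) : ℝ :=
  ∫ x : Eu n, |u x| / (1 + ‖x‖ ^ ((n : ℝ) + 2 * s))

/-- Viscosity supersolution `𝓜⁻[u] ≤ g` in `Ω` (the function `g` may incorporate
zeroth-order terms evaluated at `(x, u(x))`): every `C²` test function in `L¹_s`
touching `u` from below at a point of `Ω` satisfies `𝓜⁻[φ](x) ≤ g(x)`. -/
def ViscSupersol (n : ℕ) (s lam Lam : ℝ) (Ω : Set (Eu n)) (u g : Eu n → ℝ) : Prop :=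
  ∀ x ∈ Ω, ∀ φ : Eu n → ℝ, MemL1s n s φ → ContDiffAt ℝ 2 φ x →
    φ x = u x → (∀ y, φ y ≤ u y) → PucciInf n s lam Lam φ x ≤ g x

/-- Viscosity subsolution `𝓜⁻[u] ≥ g` in `Ω`. -/
def ViscSubsol (n : ℕ) (s lam Lam : ℝ) (Ω : Set (Eu n)) (u g : Eu n → ℝ) : Prop :=
  ∀ x ∈ Ω, ∀ φ : Eu n → ℝ, MemL1s n s φ → ContDiffAt ℝ 2 φ x →
    φ x = u x → (∀ y, u y ≤ φ y) → g x ≤ PucciInf n s lam Lam φ x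

open scoped Topology

lemma rpow_add_rpow_le_two_add {A B β : ℝ} (hA : 0 ≤ A) (hB : 0 ≤ B) (h0 : 0 ≤ β) (h2 : β ≤ 2) :
    A ^ β + B ^ β ≤ 2 + β / 2 * (A ^ 2 + B ^ 2 - 2) := by
  have key : ∀ {X : ℝ}, 0 ≤ X → X ^ β ≤ 1 + β / 2 * (X ^ 2 - 1) := by
    intro X hX
    have h := rpow_one_add_le_one_add_mul_self (s := X ^ 2 - 1) (by nlinarith)
      (p := β / 2) (by linarith) (by linarith)
    rw [add_sub_cancel, ← Real.rpow_natCast, ← Real.rpow_mul hX] at h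
    push_cast at h
    rwa [mul_div_cancel₀ _ two_ne_zero, Real.rpow_two] at h
  linarith [key hA, key hB]

lemma two_mul_le_rpow_add_rpow {A B β : ℝ} (hA : 0 ≤ A) (hB : 0 ≤ B) (h2 : β ≤ 2)
    (hAB : A * B ≤ 1) : 2 * (A * B) ≤ A ^ β + B ^ β := by
  have h1 : A * B ≤ (A * B) ^ (β / 2) :=
    Real.self_le_rpow_of_le_one (mul_nonneg hA hB) hAB (by linarith)
  have h3 : ∀ {X : ℝ}, 0 ≤ X → X ^ β = (X ^ (β / 2)) ^ 2 := by
    intro X hX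
    rw [← Real.rpow_natCast, ← Real.rpow_mul hX]
    congr 1
    push_cast; ring
  rw [Real.mul_rpow hA hB] at h1
  rw [h3 hA, h3 hB]
  nlinarith [sq_nonneg (A ^ (β / 2) - B ^ (β / 2))]

/-- The density `(1 - r) ^ (s - 1) * r ^ (-2 s)` of an (improper) Beta integral. -/
def betaDensity (s r : ℝ) : ℝ := (1 - r) ^ (s - 1) * r ^ (-2 * s)

lemma intervalIntegrable_betaDensity {s a b : ℝ} (hs : 0 < s) (ha : 0 < a) (hb : 0 < b) :
    IntervalIntegrable (betaDensity s) volume a b := by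
  have h := (intervalIntegral.intervalIntegrable_rpow' (a := 1 - a) (b := 1 - b)
    (r := s - 1) (by linarith)).comp_sub_left 1
  simp only [sub_sub_cancel] at h
  refine h.mul_continuousOn ?_
  intro r hr
  have : 0 < r := lt_of_lt_of_le (lt_min ha hb) hr.1
  exact (Real.continuousAt_rpow_const _ _ (Or.inl this.ne')).continuousWithinAt

lemma continuousAt_betaDensity {s t : ℝ} (h0 : 0 < t) (h1 : t < 1) :
    ContinuousAt (betaDensity s) t := by
  refine ContinuousAt.mul ?_ (Real.continuousAt_rpow_const _ _ (Or.inl h0.ne'))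
  exact (continuousAt_const.sub continuousAt_id).rpow_const (Or.inl (by simp; linarith))

lemma measurable_betaDensity (s : ℝ) : Measurable (betaDensity s) := by
  unfold betaDensity; fun_prop

/-- A primitive of `betaDensity`. -/
def betaPrim (s t : ℝ) : ℝ := ∫ r in (1 / 2 : ℝ)..t, betaDensity s r

lemma hasDerivAt_betaPrim {s t : ℝ} (hs : 0 < s) (h0 : 0 < t) (h1 : t < 1) :
    HasDerivAt (betaPrim s) (betaDensity s t) t :=
  intervalIntegral.integral_hasDerivAt_right
    (intervalIntegrable_betaDensity hs (by norm_num) h0)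
    ((measurable_betaDensity s).stronglyMeasurable.stronglyMeasurableAtFilter)
    (continuousAt_betaDensity h0 h1)

lemma continuousWithinAt_betaPrim_one {s : ℝ} (hs : 0 < s) :
    ContinuousWithinAt (betaPrim s) (Iic 1) 1 := by
  have h := intervalIntegral.continuousOn_primitive_interval' (a := (1 / 2 : ℝ))
    (intervalIntegrable_betaDensity (a := 1 / 2) (b := 1) hs (by norm_num) one_pos)
    left_mem_uIcc 1 right_mem_uIcc
  rw [uIcc_of_le (by norm_num)] at h
  exact h.mono_of_mem_nhdsWithin (Icc_mem_nhdsLE (by norm_num))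

lemma abs_betaPrim_sub_le {s t : ℝ} (hs : 0 < s) (hs1 : s < 1) (h0 : 0 < t) (h1 : t ≤ 1 / 2) :
    |betaPrim s t - betaPrim s (t / (1 + t))| ≤ 8 * t ^ (2 - 2 * s) := by
  have hpos : 0 < t / (1 + t) := by positivity
  have hle : t / (1 + t) ≤ t := div_le_self h0.le (by linarith)
  have hhalf : t / 2 ≤ t / (1 + t) := by gcongr; linarith
  have hdiff : t - t / (1 + t) ≤ t ^ 2 := by
    have : t - t / (1 + t) = t ^ 2 / (1 + t) := by field_simp; ring
    rw [this]
    exact div_le_self (sq_nonneg t) (by linarith)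
  unfold betaPrim
  rw [intervalIntegral.integral_interval_sub_left
    (intervalIntegrable_betaDensity hs (by norm_num) h0)
    (intervalIntegrable_betaDensity hs (by norm_num) hpos), ← Real.norm_eq_abs]
  have hb := intervalIntegral.norm_integral_le_of_norm_le_const (f := betaDensity s)
    (a := t / (1 + t)) (b := t) (C := 8 * t ^ (-2 * s)) ?_
  · refine hb.trans ?_
    rw [abs_of_nonneg (by linarith)]
    have : t ^ (2 - 2 * s) = t ^ (-2 * s) * t ^ 2 := by
      rw [← Real.rpow_natCast, ← Real.rpow_add h0]; congr 1; push_cast; ring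
    rw [this, ← mul_assoc]
    gcongr
  · intro r hr
    rw [uIoc_of_le hle] at hr
    have hr0 : 0 < r := hpos.trans hr.1
    have hr1 : r ≤ 1 / 2 := hr.2.trans h1
    rw [betaDensity, Real.norm_of_nonneg (mul_nonneg (Real.rpow_nonneg (by linarith) _)
      (Real.rpow_nonneg hr0.le _))]
    have e1 : (1 - r) ^ (s - 1) ≤ 2 := by
      calc (1 - r) ^ (s - 1) ≤ (1 / 2 : ℝ) ^ (s - 1) :=
            Real.rpow_le_rpow_of_nonpos (by norm_num) (by linarith) (by linarith)
        _ ≤ (1 / 2 : ℝ) ^ (-1 : ℝ) :=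
            Real.rpow_le_rpow_of_exponent_ge (by norm_num) (by norm_num) (by linarith)
        _ = 2 := by rw [Real.rpow_neg_one]; norm_num
    have e2 : r ^ (-2 * s) ≤ 4 * t ^ (-2 * s) := by
      calc r ^ (-2 * s) ≤ (t / 2) ^ (-2 * s) :=
            Real.rpow_le_rpow_of_nonpos (by linarith) (by linarith [hr.1]) (by linarith)
        _ = (1 / 2 : ℝ) ^ (-2 * s) * t ^ (-2 * s) := by
            rw [← Real.mul_rpow (by norm_num) h0.le]; ring_nf
        _ ≤ (1 / 2 : ℝ) ^ (-2 : ℝ) * t ^ (-2 * s) := by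
            gcongr ?_ * _
            exact Real.rpow_le_rpow_of_exponent_ge (by norm_num) (by norm_num) (by linarith)
        _ = 4 * t ^ (-2 * s) := by
            rw [Real.rpow_neg (by norm_num)]; norm_num
    calc (1 - r) ^ (s - 1) * r ^ (-2 * s) ≤ 2 * (4 * t ^ (-2 * s)) := by
          gcongr
      _ = 8 * t ^ (-2 * s) := by ring

lemma integrableOn_mul_rpow_of_le {g : ℝ → ℝ} {A s κ : ℝ} (hs1 : s < 1) (hκ : κ < 2 * s)
    (hg : Measurable g) (h1 : ∀ t ∈ Ioc (0 : ℝ) 1, |g t| ≤ A * t ^ 2)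
    (h2 : ∀ t ∈ Ioi (1 : ℝ), |g t| ≤ A * t ^ κ) :
    IntegrableOn (fun t => g t * t ^ (-1 - 2 * s)) (Ioi 0) := by
  have hm : Measurable fun t : ℝ => g t * t ^ (-1 - 2 * s) := by fun_prop
  rw [← Ioc_union_Ioi_eq_Ioi (zero_le_one' ℝ)]
  refine IntegrableOn.union ?_ ?_
  · have hi : IntegrableOn (fun t : ℝ => A * t ^ (1 - 2 * s)) (Ioc 0 1) := by
      rw [← intervalIntegrable_iff_integrableOn_Ioc_of_le zero_le_one]
      exact (intervalIntegral.intervalIntegrable_rpow' (by linarith)).const_mul A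
    refine hi.mono' hm.aestronglyMeasurable ?_
    filter_upwards [ae_restrict_mem measurableSet_Ioc] with t ht
    have e : t ^ (1 - 2 * s) = t ^ 2 * t ^ (-1 - 2 * s) := by
      rw [← Real.rpow_natCast, ← Real.rpow_add ht.1]; congr 1; push_cast; ring
    rw [norm_mul, Real.norm_eq_abs, Real.norm_of_nonneg (Real.rpow_nonneg ht.1.le _), e,
      ← mul_assoc]
    gcongr
    exacts [Real.rpow_nonneg ht.1.le _, h1 t ht]
  · have hi : IntegrableOn (fun t : ℝ => A * t ^ (κ - 1 - 2 * s)) (Ioi 1) :=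
      (integrableOn_Ioi_rpow_of_lt (by linarith) one_pos).const_mul A
    refine hi.mono' hm.aestronglyMeasurable ?_
    filter_upwards [ae_restrict_mem measurableSet_Ioi] with t ht
    have ht0 : 0 < t := zero_lt_one.trans ht
    have e : t ^ (κ - 1 - 2 * s) = t ^ κ * t ^ (-1 - 2 * s) := by
      rw [← Real.rpow_add ht0]; congr 1; ring
    rw [norm_mul, Real.norm_eq_abs, Real.norm_of_nonneg (Real.rpow_nonneg ht0.le _), e,
      ← mul_assoc]
    gcongr
    exact h2 t ht

/-- The second difference at `1`, with step `t`, of the half-line profile `z ↦ max z 0 ^ s`. -/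
def profileDiff (s t : ℝ) : ℝ := (1 + t) ^ s + max (1 - t) 0 ^ s - 2

lemma abs_profileDiff_le_sq {s t : ℝ} (hs : 0 < s) (hs1 : s < 1) (h0 : 0 ≤ t) (h1 : t ≤ 1) :
    |profileDiff s t| ≤ 2 * t ^ 2 := by
  unfold profileDiff
  rw [max_eq_left (by linarith), abs_le]
  have hu := rpow_add_rpow_le_two_add (A := 1 + t) (B := 1 - t) (β := s) (by linarith)
    (by linarith) hs.le (by linarith)
  have hl := two_mul_le_rpow_add_rpow (A := 1 + t) (B := 1 - t) (β := s) (by linarith)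
    (by linarith) (by linarith) (by nlinarith)
  constructor <;> nlinarith [sq_nonneg t]

lemma abs_profileDiff_le_rpow {s t : ℝ} (hs : 0 < s) (hs1 : s < 1) (h1 : 1 < t) :
    |profileDiff s t| ≤ 2 * t ^ s := by
  unfold profileDiff
  rw [max_eq_right (by linarith), Real.zero_rpow hs.ne', add_zero, abs_le]
  have ht : 1 ≤ t ^ s := Real.one_le_rpow h1.le hs.le
  have h2 : (1 + t) ^ s ≤ 1 ^ s + t ^ s :=
    Real.rpow_add_le_add_rpow zero_le_one (by linarith) hs.le hs1.le
  have h3 : 0 ≤ (1 + t) ^ s := by positivity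
  rw [Real.one_rpow] at h2
  constructor <;> linarith

lemma measurable_profileDiff (s : ℝ) : Measurable (profileDiff s) := by
  unfold profileDiff; fun_prop

lemma integrableOn_profileDiff {s : ℝ} (hs : 0 < s) (hs1 : s < 1) :
    IntegrableOn (fun t => profileDiff s t * t ^ (-1 - 2 * s)) (Ioi 0) :=
  integrableOn_mul_rpow_of_le (A := 2) (κ := s) hs1 (by linarith) (measurable_profileDiff s)
    (fun _ ht => abs_profileDiff_le_sq hs hs1 ht.1.le ht.2)
    (fun _ ht => abs_profileDiff_le_rpow hs hs1 ht)

lemma hasDerivAt_betaPrim_div {s t : ℝ} (hs : 0 < s) (h0 : 0 < t) :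
    HasDerivAt (fun t => betaPrim s (t / (1 + t))) ((1 + t) ^ (s - 1) * t ^ (-2 * s)) t := by
  have hq : 0 < 1 + t := by linarith
  have h1 : HasDerivAt (fun t : ℝ => t / (1 + t)) (1 / (1 + t) ^ 2) t := by
    have := (hasDerivAt_id t).div ((hasDerivAt_id t).const_add 1) hq.ne'
    refine this.congr_deriv ?_
    simp
  have h2 := (hasDerivAt_betaPrim hs (t := t / (1 + t)) (by positivity)
    ((div_lt_one hq).2 (by linarith))).comp t h1
  refine h2.congr_deriv ?_
  have e : 1 - t / (1 + t) = (1 + t)⁻¹ := by field_simp; ring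
  rw [betaDensity, e, Real.div_rpow h0.le hq.le, Real.inv_rpow hq.le,
    ← Real.rpow_neg hq.le, one_div, ← Real.rpow_natCast, ← Real.rpow_neg hq.le,
    div_eq_mul_inv, ← Real.rpow_neg hq.le]
  rw [show (1 + t) ^ (s - 1) = (1 + t) ^ (-(s - 1)) * (1 + t) ^ (-(-2 * s)) *
    (1 + t) ^ (-((2 : ℕ) : ℝ)) by
      rw [← Real.rpow_add hq, ← Real.rpow_add hq]; congr 1; push_cast; ring]
  ring

/-- A primitive of the weighted `profileDiff`, up to a `betaPrim` term. -/
def profilePrim (s t : ℝ) : ℝ :=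
  -(1 / (2 * s)) * (profileDiff s t * t ^ (-2 * s)) + 1 / 2 * betaPrim s (t / (1 + t))

lemma hasDerivAt_profilePrim_of_lt {s t : ℝ} (hs : 0 < s) (h0 : 0 < t) (h1 : t < 1) :
    HasDerivAt (fun t => profilePrim s t - 1 / 2 * betaPrim s t)
      (profileDiff s t * t ^ (-1 - 2 * s)) t := by
  have hD : HasDerivAt (profileDiff s) (s * (1 + t) ^ (s - 1) - s * (1 - t) ^ (s - 1)) t := by
    have a1 := ((hasDerivAt_id t).const_add 1).rpow_const (p := s) (Or.inl (by simp; linarith))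
    have a2 := ((hasDerivAt_id t).const_sub 1).rpow_const (p := s) (Or.inl (by simp; linarith))
    have a3 := (a1.add a2).sub_const 2
    refine (a3.congr_of_eventuallyEq ?_).congr_deriv (by simp; ring)
    filter_upwards [Iio_mem_nhds h1] with r hr
    have : (0 : ℝ) ≤ 1 - r := by linarith [mem_Iio.1 hr]
    simp [profileDiff, this]
  have hp := Real.hasDerivAt_rpow_const (x := t) (p := -2 * s) (Or.inl h0.ne')
  have := (((hD.mul hp).const_mul (-(1 / (2 * s)))).add
    ((hasDerivAt_betaPrim_div hs h0).const_mul (1 / 2))).sub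
    ((hasDerivAt_betaPrim hs h0 h1).const_mul (1 / 2))
  refine this.congr_deriv ?_
  rw [betaDensity, show (-2 * s - 1 : ℝ) = -1 - 2 * s by ring]
  field_simp
  ring

lemma hasDerivAt_profilePrim_of_gt {s t : ℝ} (hs : 0 < s) (h1 : 1 < t) :
    HasDerivAt (profilePrim s) (profileDiff s t * t ^ (-1 - 2 * s)) t := by
  have h0 : 0 < t := by linarith
  have hD : HasDerivAt (profileDiff s) (s * (1 + t) ^ (s - 1)) t := by
    have a1 := ((hasDerivAt_id t).const_add 1).rpow_const (p := s) (Or.inl (by simp; linarith))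
    have a3 := a1.sub_const 2
    refine (a3.congr_of_eventuallyEq ?_).congr_deriv (by simp)
    filter_upwards [Ioi_mem_nhds h1] with r hr
    have : (1 - r : ℝ) ≤ 0 := by linarith [mem_Ioi.1 hr]
    simp [profileDiff, this, Real.zero_rpow hs.ne']
  have hp := Real.hasDerivAt_rpow_const (x := t) (p := -2 * s) (Or.inl h0.ne')
  have := ((hD.mul hp).const_mul (-(1 / (2 * s)))).add
    ((hasDerivAt_betaPrim_div hs h0).const_mul (1 / 2))
  refine this.congr_deriv ?_
  rw [show (-2 * s - 1 : ℝ) = -1 - 2 * s by ring]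
  field_simp
  ring

lemma continuousAt_profilePrim {s t : ℝ} (hs : 0 < s) (h0 : 0 < t) :
    ContinuousAt (profilePrim s) t := by
  have h1 : ContinuousAt (fun t : ℝ => (1 + t) ^ s) t :=
    (continuousAt_const.add continuousAt_id).rpow_const (Or.inr hs.le)
  have h2 : ContinuousAt (fun t : ℝ => max (1 - t) 0 ^ s) t :=
    ((continuous_const.sub continuous_id).max continuous_const).continuousAt.rpow_const
      (Or.inr hs.le)
  have h3 := (Real.hasDerivAt_rpow_const (x := t) (p := -2 * s) (Or.inl h0.ne')).continuousAt
  exact ((((h1.add h2).sub continuousAt_const).mul h3).const_mul _).add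
    ((hasDerivAt_betaPrim_div hs h0).continuousAt.const_mul _)

lemma tendsto_profilePrim_zero {s : ℝ} (hs : 0 < s) (hs1 : s < 1) :
    Tendsto (fun t => profilePrim s t - 1 / 2 * betaPrim s t) (𝓝[>] 0) (𝓝 0) := by
  have hlim : Tendsto (fun t : ℝ => (1 / s + 4) * t ^ (2 - 2 * s)) (𝓝[>] 0) (𝓝 0) := by
    have := (Real.continuousAt_rpow_const 0 (2 - 2 * s) (Or.inr (by linarith))).tendsto.mono_left
      (nhdsWithin_le_nhds (s := Ioi 0))
    rw [Real.zero_rpow (by linarith)] at this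
    simpa using this.const_mul (1 / s + 4)
  refine squeeze_zero_norm' ?_ hlim
  filter_upwards [Ioc_mem_nhdsGT (show (0 : ℝ) < 1 / 2 by norm_num)] with t ht
  have h0 : 0 < t := ht.1
  have hb := abs_betaPrim_sub_le hs hs1 ht.1 ht.2
  have hd := abs_profileDiff_le_sq hs hs1 ht.1.le (by linarith [ht.2])
  have e : t ^ (2 - 2 * s) = t ^ 2 * t ^ (-2 * s) := by
    rw [← Real.rpow_natCast, ← Real.rpow_add ht.1]; congr 1; push_cast; ring
  have e' : profilePrim s t - 1 / 2 * betaPrim s t = -(1 / (2 * s)) *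
      (profileDiff s t * t ^ (-2 * s)) + -(1 / 2) * (betaPrim s t - betaPrim s (t / (1 + t))) := by
    unfold profilePrim; ring
  rw [e', Real.norm_eq_abs]
  refine (abs_add_le _ _).trans ?_
  rw [abs_mul, abs_mul, abs_mul, abs_neg, abs_neg, abs_of_pos (show 0 < 1 / (2 * s) by positivity),
    abs_of_nonneg (Real.rpow_nonneg ht.1.le (-2 * s)),
    abs_of_pos (show (0 : ℝ) < 1 / 2 by norm_num)]
  calc 1 / (2 * s) * (|profileDiff s t| * t ^ (-2 * s)) +
        1 / 2 * |betaPrim s t - betaPrim s (t / (1 + t))|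
      ≤ 1 / (2 * s) * (2 * t ^ 2 * t ^ (-2 * s)) + 1 / 2 * (8 * t ^ (2 - 2 * s)) := by
        gcongr
    _ = (1 / s + 4) * t ^ (2 - 2 * s) := by rw [e]; field_simp; ring

lemma tendsto_profilePrim_atTop {s : ℝ} (hs : 0 < s) (hs1 : s < 1) :
    Tendsto (profilePrim s) atTop (𝓝 (1 / 2 * betaPrim s 1)) := by
  have h1 : Tendsto (fun t : ℝ => profileDiff s t * t ^ (-2 * s)) atTop (𝓝 0) := by
    have hlim : Tendsto (fun t : ℝ => 2 * t ^ (-s)) atTop (𝓝 0) := by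
      simpa using (tendsto_rpow_neg_atTop hs).const_mul 2
    refine squeeze_zero_norm' ?_ hlim
    filter_upwards [eventually_gt_atTop 1] with t ht
    have h0 : 0 < t := by linarith
    rw [norm_mul, Real.norm_eq_abs, Real.norm_of_nonneg (Real.rpow_nonneg h0.le _),
      show -s = s + -2 * s by ring, Real.rpow_add h0, ← mul_assoc]
    gcongr
    exact abs_profileDiff_le_rpow hs hs1 ht
  have h2 : Tendsto (fun t : ℝ => t / (1 + t)) atTop (𝓝[≤] 1) := by
    refine tendsto_nhdsWithin_iff.2 ⟨?_, ?_⟩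
    · have : Tendsto (fun t : ℝ => 1 - (1 + t)⁻¹) atTop (𝓝 (1 - 0)) :=
        (tendsto_inv_atTop_zero.comp (tendsto_atTop_add_const_left _ 1 tendsto_id)).const_sub 1
      rw [sub_zero] at this
      refine this.congr' ?_
      filter_upwards [eventually_gt_atTop 0] with t ht
      field_simp
      ring
    · filter_upwards [eventually_gt_atTop 0] with t ht
      show t / (1 + t) ≤ 1
      exact (div_le_one (by linarith)).2 (by linarith)
  have h3 := (continuousWithinAt_betaPrim_one hs).tendsto.comp h2
  have h4 := (h1.const_mul (-(1 / (2 * s)))).add (h3.const_mul (1 / 2))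
  rwa [mul_zero, zero_add] at h4

/-- The half-line profile `z ↦ max z 0 ^ s` is annihilated by the fractional Laplacian of
order `2s`. -/
theorem integral_profileDiff {s : ℝ} (hs : 0 < s) (hs1 : s < 1) :
    ∫ t in Ioi 0, profileDiff s t * t ^ (-1 - 2 * s) = 0 := by
  have hi := integrableOn_profileDiff hs hs1
  have hi1 := hi.mono_set (show Ioc (0 : ℝ) 1 ⊆ Ioi 0 from Ioc_subset_Ioi_self)
  have hi2 := hi.mono_set (Ioi_subset_Ioi (zero_le_one' ℝ))
  rw [← Ioc_union_Ioi_eq_Ioi (zero_le_one' ℝ),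
    setIntegral_union (Set.Ioc_disjoint_Ioi le_rfl) measurableSet_Ioi hi1 hi2,
    ← intervalIntegral.integral_of_le zero_le_one,
    intervalIntegral.integral_eq_sub_of_hasDerivAt_of_tendsto zero_lt_one
      (fun t ht => hasDerivAt_profilePrim_of_lt hs ht.1 ht.2)
      ((intervalIntegrable_iff_integrableOn_Ioc_of_le zero_le_one).2 hi1)
      (tendsto_profilePrim_zero hs hs1)
      (((continuousAt_profilePrim hs one_pos).continuousWithinAt.sub
        (((continuousWithinAt_betaPrim_one hs).mono Iio_subset_Iic_self).const_mul _)).tendsto),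
    integral_Ioi_of_hasDerivAt_of_tendsto (continuousAt_profilePrim hs one_pos).continuousWithinAt
      (fun t ht => hasDerivAt_profilePrim_of_gt hs ht) hi2 (tendsto_profilePrim_atTop hs hs1)]
  simp only [Pi.sub_apply]
  ring

/-- The second difference at `0` in direction of slope `b` of the profile `max (δ - t b) 0 ^ s`. -/
def halfSpaceDiff (s δ b t : ℝ) : ℝ :=
  max (δ - t * b) 0 ^ s + max (δ + t * b) 0 ^ s - 2 * δ ^ s

lemma halfSpaceDiff_mul_rpow {s δ b t : ℝ} (hδ : 0 < δ) (hb : b ≠ 0) (ht : 0 < t) :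
    halfSpaceDiff s δ b t * t ^ (-1 - 2 * s) = δ ^ s * (|b| / δ) ^ (1 + 2 * s) *
      (profileDiff s (|b| / δ * t) * (|b| / δ * t) ^ (-1 - 2 * s)) := by
  have hk : 0 < |b| / δ := by positivity
  have hmul : ∀ c : ℝ, max (δ + c) 0 ^ s = δ ^ s * max (1 + c / δ) 0 ^ s := by
    intro c
    rw [← Real.mul_rpow hδ.le (le_max_right _ _), mul_max_of_nonneg _ _ hδ.le]
    congr 2
    · field_simp
    · simp
  have hsymm : halfSpaceDiff s δ b t = halfSpaceDiff s δ |b| t := by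
    rcases abs_cases b with h | h <;> rw [h.1]
    simp only [halfSpaceDiff, mul_neg, sub_neg_eq_add]
    ring_nf
  have hD : halfSpaceDiff s δ |b| t = δ ^ s * profileDiff s (|b| / δ * t) := by
    rw [halfSpaceDiff, profileDiff, sub_eq_add_neg δ, hmul, hmul,
      max_eq_left (a := 1 + t * |b| / δ) (by positivity),
      show t * |b| / δ = |b| / δ * t by ring, show 1 + -(t * |b|) / δ = 1 - |b| / δ * t by ring]
    ring
  rw [hsymm, hD, Real.mul_rpow hk.le ht.le]
  have : (|b| / δ) ^ (1 + 2 * s) * (|b| / δ) ^ (-1 - 2 * s) = 1 := by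
    rw [← Real.rpow_add hk, show 1 + 2 * s + (-1 - 2 * s) = 0 by ring, Real.rpow_zero]
  linear_combination (-(δ ^ s * profileDiff s (|b| / δ * t) * t ^ (-1 - 2 * s))) * this

lemma integrableOn_halfSpaceDiff {s δ b : ℝ} (hs : 0 < s) (hs1 : s < 1) (hδ : 0 < δ) :
    IntegrableOn (fun t => halfSpaceDiff s δ b t * t ^ (-1 - 2 * s)) (Ioi 0) := by
  rcases eq_or_ne b 0 with rfl | hb
  · simp only [halfSpaceDiff, mul_zero, sub_zero, add_zero, max_eq_left hδ.le]
    ring_nf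
    exact integrableOn_zero
  · rw [integrableOn_congr_fun (fun t (ht : t ∈ Ioi (0 : ℝ)) =>
      halfSpaceDiff_mul_rpow (s := s) hδ hb ht) measurableSet_Ioi]
    refine Integrable.const_mul ?_ _
    have := (integrableOn_Ioi_comp_mul_left_iff
      (fun t => profileDiff s t * t ^ (-1 - 2 * s)) 0 (show 0 < |b| / δ by positivity)).2
    rw [mul_zero] at this
    exact this (integrableOn_profileDiff hs hs1)

lemma integral_halfSpaceDiff {s δ b : ℝ} (hs : 0 < s) (hs1 : s < 1) (hδ : 0 < δ) :
    ∫ t in Ioi 0, halfSpaceDiff s δ b t * t ^ (-1 - 2 * s) = 0 := by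
  rcases eq_or_ne b 0 with rfl | hb
  · simp only [halfSpaceDiff, mul_zero, sub_zero, add_zero, max_eq_left hδ.le]
    ring_nf
    simp
  · rw [setIntegral_congr_fun measurableSet_Ioi (fun t ht => halfSpaceDiff_mul_rpow hδ hb ht),
      integral_const_mul, integral_comp_mul_left_Ioi
      (fun t => profileDiff s t * t ^ (-1 - 2 * s)) 0 (show 0 < |b| / δ by positivity),
      mul_zero, integral_profileDiff hs hs1]
    simp

lemma rpow_sub_rpow_le_mul {s d l m η : ℝ} (hs : 0 < s) (hs1 : s < 1) (hm : 0 < m) (hmd : m ≤ d)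
    (hη : 0 ≤ η) (hl0 : 0 ≤ l) (hl : l ≤ d + η) : l ^ s - d ^ s ≤ m ^ (s - 1) * η := by
  have hd : 0 < d := hm.trans_le hmd
  have h1 : l ^ s ≤ (d + η) ^ s := Real.rpow_le_rpow hl0 hl hs.le
  have h2 : (d + η) ^ s = d ^ s * (1 + η / d) ^ s := by
    rw [← Real.mul_rpow hd.le (by positivity)]; congr 1; field_simp
  have h3 := rpow_one_add_le_one_add_mul_self (s := η / d) (p := s)
    (by linarith [div_nonneg hη hd.le]) hs.le hs1.le
  have h4 : d ^ s * (1 + s * (η / d)) = d ^ s + s * (d ^ (s - 1) * η) := by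
    rw [Real.rpow_sub_one hd.ne']; ring
  have h5 : d ^ (s - 1) ≤ m ^ (s - 1) := Real.rpow_le_rpow_of_nonpos hm hmd (by linarith)
  have h6 : d ^ s * (1 + η / d) ^ s ≤ d ^ s * (1 + s * (η / d)) := by gcongr
  have h7 : s * (d ^ (s - 1) * η) ≤ 1 * (m ^ (s - 1) * η) := by gcongr
  linarith

lemma rpow_sub_rpow_le_rpow {s d l η : ℝ} (hs : 0 < s) (hs1 : s < 1) (hd : 0 ≤ d)
    (hη : 0 ≤ η) (hl0 : 0 ≤ l) (hl : l ≤ d + η) : l ^ s - d ^ s ≤ η ^ s := by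
  have h1 : l ^ s ≤ (d + η) ^ s := Real.rpow_le_rpow hl0 hl hs.le
  linarith [Real.rpow_add_le_add_rpow hd hη hs.le hs1.le]

/-- Radial majorant for the error made by replacing the distance to the complement of the unit
ball by the distance to the complement of a tangent half-space. -/
def errorMajorant (s δ t : ℝ) : ℝ :=
  if t ≤ δ / 2 then 8 * (δ / 2) ^ (s - 1) * t ^ 2
  else if t ≤ 1 then 8 * t ^ (2 * s) else 2 * t ^ s

lemma rpow_sub_rpow_le_errorMajorant {s δ t d l : ℝ} (hs : 0 < s) (hs1 : s < 1) (hδ : 0 < δ)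
    (hδ1 : δ ≤ 1) (ht : 0 < t) (hd : 0 ≤ d) (hl0 : 0 ≤ l) (hl : l ≤ d + 8 * t ^ 2)
    (hdt : δ - t ≤ d) (hlt : l ≤ δ + t) : l ^ s - d ^ s ≤ errorMajorant s δ t := by
  unfold errorMajorant
  split_ifs with h1 h2
  · have := rpow_sub_rpow_le_mul hs hs1 (half_pos hδ) (by linarith) (by positivity) hl0 hl
    linarith
  · refine (rpow_sub_rpow_le_rpow hs hs1 hd (by positivity) hl0 hl).trans ?_
    rw [Real.mul_rpow (by norm_num) (by positivity), Real.rpow_mul ht.le, Real.rpow_two]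
    gcongr
    exact (Real.rpow_le_rpow_of_exponent_le (by norm_num) hs1.le).trans (by simp)
  · have h3 : l ^ s ≤ (2 * t) ^ s := Real.rpow_le_rpow hl0 (by linarith) hs.le
    have h4 : (2 : ℝ) ^ s ≤ 2 :=
      (Real.rpow_le_rpow_of_exponent_le (by norm_num) hs1.le).trans (by simp)
    rw [Real.mul_rpow (by norm_num) ht.le] at h3
    nlinarith [Real.rpow_nonneg hd s, Real.rpow_nonneg ht.le s]

lemma errorMajorant_integral_le {s δ : ℝ} (hs : 0 < s) (hs1 : s < 1) (hδ : 0 < δ) (hδ1 : δ ≤ 1) :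
    IntegrableOn (fun t => errorMajorant s δ t * t ^ (-1 - 2 * s)) (Ioi 0) ∧
    (1 - s) * ∫ t in Ioi 0, errorMajorant s δ t * t ^ (-1 - 2 * s) ≤
      4 + 8 * ((1 - s) * (Real.log 2 + |Real.log δ|)) + 2 / s := by
  set f := fun t => errorMajorant s δ t * t ^ (-1 - 2 * s) with hf
  have hδ2 : 0 < δ / 2 := by linarith
  have e1 : EqOn f (fun t => 8 * (δ / 2) ^ (s - 1) * t ^ (1 - 2 * s)) (Ioc 0 (δ / 2)) := by
    intro t ht
    simp only [hf, errorMajorant, if_pos ht.2]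
    rw [mul_assoc, ← Real.rpow_natCast t 2, ← Real.rpow_add ht.1]
    congr 2; push_cast; ring
  have e2 : EqOn f (fun t => 8 * t⁻¹) (Ioc (δ / 2) 1) := by
    intro t ht
    have ht0 : 0 < t := hδ2.trans ht.1
    simp only [hf, errorMajorant, if_neg ht.1.not_ge, if_pos ht.2]
    rw [mul_assoc, ← Real.rpow_add ht0, ← Real.rpow_neg_one]
    congr 2; ring
  have e3 : EqOn f (fun t => 2 * t ^ (-1 - s)) (Ioi 1) := by
    intro t ht
    have ht1 : 1 < t := ht
    have ht0 : 0 < t := by linarith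
    simp only [hf, errorMajorant, if_neg (show ¬ t ≤ δ / 2 by linarith), if_neg ht1.not_ge]
    rw [mul_assoc, ← Real.rpow_add ht0]
    congr 2; ring
  have i1 : IntegrableOn f (Ioc 0 (δ / 2)) := by
    rw [integrableOn_congr_fun e1 measurableSet_Ioc,
      ← intervalIntegrable_iff_integrableOn_Ioc_of_le hδ2.le]
    exact (intervalIntegral.intervalIntegrable_rpow' (by linarith)).const_mul _
  have i2 : IntegrableOn f (Ioc (δ / 2) 1) := by
    rw [integrableOn_congr_fun e2 measurableSet_Ioc,
      ← intervalIntegrable_iff_integrableOn_Ioc_of_le (by linarith)]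
    refine (intervalIntegral.intervalIntegrable_inv ?_ continuousOn_id).const_mul _
    intro t ht
    rw [uIcc_of_le (by linarith)] at ht
    exact (hδ2.trans_le ht.1).ne'
  have i3 : IntegrableOn f (Ioi 1) := by
    rw [integrableOn_congr_fun e3 measurableSet_Ioi]
    exact (integrableOn_Ioi_rpow_of_lt (by linarith) one_pos).const_mul _
  have i23 : IntegrableOn f (Ioi (δ / 2)) := by
    rw [← Ioc_union_Ioi_eq_Ioi (show δ / 2 ≤ 1 by linarith)]
    exact i2.union i3
  have v1 : ∫ t in Ioc 0 (δ / 2), f t = 8 * ((δ / 2) ^ (1 - s) / (2 - 2 * s)) := by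
    rw [setIntegral_congr_fun measurableSet_Ioc e1, ← intervalIntegral.integral_of_le hδ2.le,
      intervalIntegral.integral_const_mul, integral_rpow (Or.inl (by linarith)),
      show 1 - 2 * s + 1 = 2 - 2 * s by ring, Real.zero_rpow (by linarith), sub_zero, mul_assoc,
      ← mul_div_assoc, ← Real.rpow_add hδ2, show s - 1 + (2 - 2 * s) = 1 - s by ring]
  have v2 : ∫ t in Ioc (δ / 2) 1, f t = 8 * Real.log (1 / (δ / 2)) := by
    rw [setIntegral_congr_fun measurableSet_Ioc e2,
      ← intervalIntegral.integral_of_le (by linarith), intervalIntegral.integral_const_mul,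
      integral_inv_of_pos hδ2 one_pos]
  have v3 : ∫ t in Ioi 1, f t = 2 * (1 / s) := by
    rw [setIntegral_congr_fun measurableSet_Ioi e3, integral_const_mul,
      integral_Ioi_rpow_of_lt (by linarith) one_pos, Real.one_rpow]
    congr 1
    rw [show -1 - s + 1 = -s by ring, neg_div_neg_eq]
  refine ⟨?_, ?_⟩
  · rw [← Ioc_union_Ioi_eq_Ioi hδ2.le]
    exact i1.union i23
  · rw [← Ioc_union_Ioi_eq_Ioi hδ2.le, setIntegral_union (Ioc_disjoint_Ioi le_rfl)
      measurableSet_Ioi i1 i23, ← Ioc_union_Ioi_eq_Ioi (show δ / 2 ≤ 1 by linarith),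
      setIntegral_union (Ioc_disjoint_Ioi le_rfl) measurableSet_Ioi i2 i3, v1, v2, v3]
    have h1 : (δ / 2) ^ (1 - s) ≤ 1 := Real.rpow_le_one hδ2.le (by linarith) (by linarith)
    have hlog : Real.log (1 / (δ / 2)) = Real.log 2 + |Real.log δ| := by
      rw [abs_of_nonpos (Real.log_nonpos hδ.le hδ1), one_div_div,
        Real.log_div two_ne_zero hδ.ne']
      ring
    have h2 : (1 - s) * (8 * ((δ / 2) ^ (1 - s) / (2 - 2 * s))) = 4 * (δ / 2) ^ (1 - s) := by
      have : (1 - s) ≠ 0 := by linarith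
      rw [show 2 - 2 * s = 2 * (1 - s) by ring]
      field_simp
      ring
    have h3 : (1 - s) * (2 * (1 / s)) ≤ 2 / s := by
      rw [show 2 / s = 1 * (2 * (1 / s)) by ring]
      gcongr
      linarith
    rw [hlog, mul_add, h2, mul_add]
    linarith

/-- The distance to the complement of the unit ball, in closed form. -/
def ballDist {n : ℕ} (z : Eu n) : ℝ := max (1 - ‖z‖) 0

lemma nontrivial_Eu {n : ℕ} (hn : 1 ≤ n) : Nontrivial (Eu n) := by
  have : Nonempty (Fin n) := ⟨⟨0, hn⟩⟩
  infer_instance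

lemma infDist_compl_ball {n : ℕ} (hn : 1 ≤ n) (z : Eu n) :
    infDist z (ball (0 : Eu n) 1)ᶜ = ballDist z := by
  have := nontrivial_Eu hn
  unfold ballDist
  rcases le_or_gt 1 ‖z‖ with h | h
  · rw [infDist_zero_of_mem (by simpa using h), max_eq_right (by linarith)]
  · rw [max_eq_left (by linarith)]
    obtain ⟨v, hv, hzv⟩ : ∃ v : Eu n, ‖v‖ = 1 ∧ z = ‖z‖ • v := by
      rcases eq_or_ne z 0 with rfl | hz
      · obtain ⟨v, hv⟩ := exists_norm_eq (Eu n) (zero_le_one' ℝ)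
        exact ⟨v, hv, by simp⟩
      · exact ⟨‖z‖⁻¹ • z, norm_smul_inv_norm hz, by
          rw [smul_smul, mul_inv_cancel₀ (norm_ne_zero_iff.2 hz), one_smul]⟩
    have hmem : v ∈ (ball (0 : Eu n) 1)ᶜ := by simp [hv]
    apply le_antisymm
    · refine (infDist_le_dist_of_mem hmem).trans_eq ?_
      have : z - v = (‖z‖ - 1) • v := by rw [sub_smul, one_smul, ← hzv]
      rw [dist_eq_norm, this, norm_smul, hv, mul_one, Real.norm_eq_abs,
        abs_of_neg (by linarith)]
      ring
    · refine (le_infDist ⟨v, hmem⟩).2 fun w hw => ?_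
      have hw1 : 1 ≤ ‖w‖ := by simpa using hw
      rw [dist_comm, dist_eq_norm]
      linarith [norm_sub_norm_le w z]

lemma ballDist_nonneg {n : ℕ} (z : Eu n) : 0 ≤ ballDist z := le_max_right _ _

lemma ballDist_le_one {n : ℕ} (z : Eu n) : ballDist z ≤ 1 :=
  max_le (by linarith [norm_nonneg z]) zero_le_one

lemma continuous_ballDist {n : ℕ} : Continuous (ballDist (n := n)) := by
  unfold ballDist; fun_prop

lemma ballDist_of_lt {n : ℕ} {x : Eu n} (hx : ‖x‖ < 1) : ballDist x = 1 - ‖x‖ :=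
  max_eq_left (by linarith)

lemma sub_le_ballDist_add {n : ℕ} (x y : Eu n) : 1 - ‖x‖ - ‖y‖ ≤ ballDist (x + y) :=
  le_max_of_le_left (by linarith [norm_add_le x y])

/-- The unit outward direction at `x`. -/
def outward {n : ℕ} (x : Eu n) : Eu n := ‖x‖⁻¹ • x

lemma norm_outward {n : ℕ} {x : Eu n} (hx : 0 < ‖x‖) : ‖outward x‖ = 1 :=
  norm_smul_inv_norm (norm_pos_iff.1 hx)

lemma inner_outward_self {n : ℕ} {x : Eu n} (hx : 0 < ‖x‖) : inner ℝ (outward x) x = ‖x‖ := by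
  rw [outward, real_inner_smul_left, real_inner_self_eq_norm_sq]
  field_simp

lemma abs_inner_outward_le {n : ℕ} {x : Eu n} (hx : 0 < ‖x‖) (y : Eu n) :
    |inner ℝ (outward x) y| ≤ ‖y‖ := by
  simpa [norm_outward hx] using abs_real_inner_le_norm (outward x) y

/-- The ball lies on one side of each tangent hyperplane. -/
lemma ballDist_add_le {n : ℕ} {x : Eu n} (hx : 0 < ‖x‖) (y : Eu n) :
    ballDist (x + y) ≤ max (1 - ‖x‖ - inner ℝ (outward x) y) 0 := by
  refine max_le_max_right _ ?_
  have h := real_inner_le_norm (outward x) (x + y)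
  rw [norm_outward hx, one_mul, inner_add_right, inner_outward_self hx] at h
  linarith

/-- The ball touches its tangent hyperplanes quadratically. -/
lemma le_ballDist_add {n : ℕ} {x : Eu n} (hx : 1 / 2 ≤ ‖x‖) (y : Eu n) :
    max (1 - ‖x‖ - inner ℝ (outward x) y) 0 ≤ ballDist (x + y) + 8 * ‖y‖ ^ 2 := by
  have hx0 : 0 < ‖x‖ := by linarith
  have ha := abs_le.1 (abs_inner_outward_le hx0 y)
  have hy := norm_nonneg y
  have hinner : inner ℝ x y = ‖x‖ * inner ℝ (outward x) y := by
    rw [outward, real_inner_smul_left, ← mul_assoc, mul_inv_cancel₀ hx0.ne', one_mul]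
  have hsq : ‖x + y‖ ≤ ‖x‖ + inner ℝ (outward x) y + 8 * ‖y‖ ^ 2 := by
    have hpos : 0 ≤ ‖x‖ + inner ℝ (outward x) y + 8 * ‖y‖ ^ 2 := by
      nlinarith [sq_nonneg (16 * ‖y‖ - 1)]
    refine abs_le_of_sq_le_sq' ?_ hpos |>.2
    rw [norm_add_sq_real, hinner]
    nlinarith [sq_nonneg (inner ℝ (outward x) y + 8 * ‖y‖ ^ 2), sq_nonneg ‖y‖]
  have h0 := ballDist_nonneg (x + y)
  have h1 : 1 - ‖x + y‖ ≤ ballDist (x + y) := le_max_left _ _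
  exact max_le (by linarith) (by positivity)

/-- The symmetric second difference. -/
def secondDiff {n : ℕ} (u : Eu n → ℝ) (x y : Eu n) : ℝ := u (x + y) + u (x - y) - 2 * u x

lemma abs_secondDiff_ballDist_rpow_le_two {n : ℕ} {β : ℝ} (hβ : 0 ≤ β) (x y : Eu n) :
    |secondDiff (fun z => ballDist z ^ β) x y| ≤ 2 := by
  have h : ∀ z : Eu n, 0 ≤ ballDist z ^ β ∧ ballDist z ^ β ≤ 1 := fun z =>
    ⟨Real.rpow_nonneg (ballDist_nonneg z) _,
      Real.rpow_le_one (ballDist_nonneg z) (ballDist_le_one z) hβ⟩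
  rw [secondDiff, abs_le]
  constructor <;> linarith [h (x + y), h (x - y), h x]

lemma abs_rpow_add_rpow_sub_le {δ a A B T β : ℝ} (hδ : 0 < δ) (hδ1 : δ ≤ 1) (hβ : 0 < β)
    (hβ2 : β ≤ 2) (ha : a ^ 2 ≤ T ^ 2) (ha1 : -δ ≤ a) (ha2 : a ≤ δ) (hA : 0 ≤ A) (hB : 0 ≤ B)
    (hA1 : A ≤ δ - a) (hB1 : B ≤ δ + a) (hA2 : δ - a ≤ A + 8 * T ^ 2)
    (hB2 : δ + a ≤ B + 8 * T ^ 2) :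
    |A ^ β + B ^ β - 2 * δ ^ β| ≤ (2 / δ ^ 2 + 64 / δ) * T ^ 2 := by
  have hform : A ^ β + B ^ β - 2 * δ ^ β = δ ^ β * ((A / δ) ^ β + (B / δ) ^ β - 2) := by
    rw [Real.div_rpow hA hδ.le, Real.div_rpow hB hδ.le]
    have : δ ^ β ≠ 0 := (Real.rpow_pos_of_pos hδ β).ne'
    field_simp
  have hABle : A * B ≤ δ ^ 2 := by
    have := mul_le_mul hA1 hB1 hB (by linarith)
    linarith [sq_nonneg a]
  have hABge : δ ^ 2 - a ^ 2 - 32 * δ * T ^ 2 ≤ A * B := by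
    have e1 : 0 ≤ (δ + a) * (A + 8 * T ^ 2 - (δ - a)) :=
      mul_nonneg (by linarith) (by linarith)
    have e2 : 0 ≤ A * (B + 8 * T ^ 2 - (δ + a)) := mul_nonneg hA (by linarith)
    have e3 : A * T ^ 2 ≤ (2 * δ) * T ^ 2 := by gcongr; linarith
    have e4 : (δ + a) * T ^ 2 ≤ (2 * δ) * T ^ 2 := by gcongr; linarith
    linarith
  have hup := rpow_add_rpow_le_two_add (A := A / δ) (B := B / δ) (β := β) (by positivity)
    (by positivity) hβ.le hβ2
  have hlow := two_mul_le_rpow_add_rpow (A := A / δ) (B := B / δ) (β := β) (by positivity)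
    (by positivity) hβ2 (by rw [div_mul_div_comm, div_le_one (by positivity)]; linarith)
  have hyδ : 0 ≤ T ^ 2 / δ ^ 2 := by positivity
  have hyδ' : 0 ≤ T ^ 2 / δ := by positivity
  have hAB2 : (A / δ) ^ 2 + (B / δ) ^ 2 - 2 ≤ 2 * (T ^ 2 / δ ^ 2) := by
    have f1 : A ^ 2 ≤ (δ - a) ^ 2 := by gcongr
    have f2 : B ^ 2 ≤ (δ + a) ^ 2 := by gcongr
    rw [div_pow, div_pow, ← add_div, sub_le_iff_le_add, div_le_iff₀ (by positivity), add_mul,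
      mul_assoc, div_mul_cancel₀ _ (by positivity)]
    linarith
  have hABge' : 1 - T ^ 2 / δ ^ 2 - 32 * (T ^ 2 / δ) ≤ A / δ * (B / δ) := by
    have e : (1 - T ^ 2 / δ ^ 2 - 32 * (T ^ 2 / δ)) * (δ * δ) = δ ^ 2 - T ^ 2 - 32 * δ * T ^ 2 := by
      field_simp
    rw [div_mul_div_comm, le_div_iff₀ (by positivity), e]
    linarith
  have hβAB : β / 2 * ((A / δ) ^ 2 + (B / δ) ^ 2 - 2) ≤ 2 * (T ^ 2 / δ ^ 2) := by
    calc β / 2 * ((A / δ) ^ 2 + (B / δ) ^ 2 - 2) ≤ β / 2 * (2 * (T ^ 2 / δ ^ 2)) := by gcongr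
      _ ≤ 1 * (2 * (T ^ 2 / δ ^ 2)) := by gcongr; linarith
      _ = _ := one_mul _
  have hfin : |(A / δ) ^ β + (B / δ) ^ β - 2| ≤ 2 * (T ^ 2 / δ ^ 2) + 64 * (T ^ 2 / δ) := by
    rw [abs_le]
    constructor <;> linarith
  rw [hform, abs_mul, abs_of_nonneg (Real.rpow_nonneg hδ.le β)]
  calc δ ^ β * |(A / δ) ^ β + (B / δ) ^ β - 2|
      ≤ 1 * (2 * (T ^ 2 / δ ^ 2) + 64 * (T ^ 2 / δ)) := by
        gcongr
        exact Real.rpow_le_one hδ.le hδ1 hβ.le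
    _ = _ := by ring

lemma abs_secondDiff_ballDist_rpow_le_sq {n : ℕ} {β : ℝ} (hβ : 0 < β) (hβ2 : β ≤ 2) {x : Eu n}
    (hx : 1 / 2 ≤ ‖x‖) (hx1 : ‖x‖ < 1) (y : Eu n) :
    |secondDiff (fun z => ballDist z ^ β) x y| ≤
      (2 / (1 - ‖x‖) ^ 2 + 64 / (1 - ‖x‖)) * ‖y‖ ^ 2 := by
  have hx0 : 0 < ‖x‖ := by linarith
  have hδ : 0 < 1 - ‖x‖ := by linarith
  rcases le_or_gt ‖y‖ (1 - ‖x‖) with hy | hy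
  · have ha := abs_le.1 (abs_inner_outward_le hx0 y)
    have u1 := ballDist_add_le hx0 y
    have u2 := ballDist_add_le hx0 (-y)
    have l1 := le_ballDist_add hx y
    have l2 := le_ballDist_add hx (-y)
    rw [norm_neg] at l2
    rw [inner_neg_right, sub_neg_eq_add, ← sub_eq_add_neg] at u2 l2
    rw [max_eq_left (by linarith)] at u1 u2 l1 l2
    rw [secondDiff, ballDist_of_lt hx1]
    exact abs_rpow_add_rpow_sub_le hδ (by linarith) hβ hβ2 (sq_le_sq' ha.1 ha.2) (by linarith)
      (by linarith) (ballDist_nonneg _) (ballDist_nonneg _) u1 u2 l1 l2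
  · refine (abs_secondDiff_ballDist_rpow_le_two hβ.le x y).trans ?_
    have h1 : 1 ≤ ‖y‖ ^ 2 / (1 - ‖x‖) ^ 2 := by
      rw [one_le_div (by positivity)]
      gcongr
    have h2 : 0 ≤ 64 / (1 - ‖x‖) * ‖y‖ ^ 2 := by positivity
    calc (2 : ℝ) ≤ 2 * (‖y‖ ^ 2 / (1 - ‖x‖) ^ 2) + 64 / (1 - ‖x‖) * ‖y‖ ^ 2 := by linarith
      _ = _ := by ring

/-- The second difference of `ballDist ^ β` at `x`, integrated against `t ^ (-1 - 2 * s)` along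
the ray in direction `θ`. -/
def rayIntegral {n : ℕ} (s β : ℝ) (x θ : Eu n) : ℝ :=
  ∫ t in Ioi (0 : ℝ), secondDiff (fun z => ballDist z ^ β) x (t • θ) * t ^ (-1 - 2 * s)

lemma continuous_secondDiff_ballDist_rpow {n : ℕ} {β : ℝ} (hβ : 0 ≤ β) (x : Eu n) :
    Continuous (secondDiff (fun z => ballDist z ^ β) x) := by
  have h : Continuous fun z : Eu n => ballDist z ^ β :=
    continuous_ballDist.rpow_const fun _ => Or.inr hβ
  unfold secondDiff
  have h1 : Continuous fun y : Eu n => ballDist (x + y) ^ β := h.comp (by fun_prop)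
  have h2 : Continuous fun y : Eu n => ballDist (x - y) ^ β := h.comp (by fun_prop)
  exact (h1.add h2).sub continuous_const

lemma integrableOn_ray {n : ℕ} {s β : ℝ} (hs : 0 < s) (hs1 : s < 1) (hβ : 0 < β) (hβ2 : β ≤ 2)
    {x : Eu n} (hx : 1 / 2 ≤ ‖x‖) (hx1 : ‖x‖ < 1) {θ : Eu n} (hθ : ‖θ‖ = 1) :
    IntegrableOn (fun t : ℝ => secondDiff (fun z => ballDist z ^ β) x (t • θ) * t ^ (-1 - 2 * s))
      (Ioi 0) := by
  have hδ : 0 < 1 - ‖x‖ := by linarith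
  have hA : 0 ≤ 2 / (1 - ‖x‖) ^ 2 + 64 / (1 - ‖x‖) := by positivity
  refine integrableOn_mul_rpow_of_le (A := 2 + (2 / (1 - ‖x‖) ^ 2 + 64 / (1 - ‖x‖))) (κ := 0) hs1
    (by linarith) ?_ ?_ ?_
  · exact ((continuous_secondDiff_ballDist_rpow hβ.le x).comp
      (continuous_id.smul continuous_const)).measurable
  · intro t ht
    have h := abs_secondDiff_ballDist_rpow_le_sq hβ hβ2 hx hx1 (t • θ)
    rw [norm_smul, hθ, mul_one, Real.norm_eq_abs, sq_abs] at h
    nlinarith [sq_nonneg t]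
  · intro t ht
    have h := abs_secondDiff_ballDist_rpow_le_two hβ.le x (t • θ)
    rw [Real.rpow_zero]
    linarith

lemma secondDiff_ballDist_rpow_le_halfSpaceDiff {n : ℕ} {s : ℝ} (hs : 0 < s)
    {x : Eu n} (hx : 1 / 2 ≤ ‖x‖) (hx1 : ‖x‖ < 1) (θ : Eu n) (t : ℝ) :
    secondDiff (fun z => ballDist z ^ s) x (t • θ) ≤
      halfSpaceDiff s (1 - ‖x‖) (inner ℝ (outward x) θ) t := by
  have h1 := ballDist_add_le (x := x) (by linarith) (t • θ)
  have h2 := ballDist_add_le (x := x) (by linarith) (-(t • θ))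
  rw [inner_neg_right] at h2
  rw [real_inner_smul_right] at h1 h2
  rw [← sub_eq_add_neg, sub_neg_eq_add] at h2
  simp only [secondDiff, halfSpaceDiff, ballDist_of_lt hx1]
  have e1 := Real.rpow_le_rpow (ballDist_nonneg _) h1 hs.le
  have e2 := Real.rpow_le_rpow (ballDist_nonneg _) h2 hs.le
  linarith

lemma halfSpaceDiff_le_secondDiff_ballDist_rpow {n : ℕ} {s : ℝ} (hs : 0 < s) (hs1 : s < 1)
    {x : Eu n} (hx : 1 / 2 ≤ ‖x‖) (hx1 : ‖x‖ < 1) {θ : Eu n} (hθ : ‖θ‖ = 1) {t : ℝ} (ht : 0 < t) :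
    halfSpaceDiff s (1 - ‖x‖) (inner ℝ (outward x) θ) t - 2 * errorMajorant s (1 - ‖x‖) t ≤
      secondDiff (fun z => ballDist z ^ s) x (t • θ) := by
  have hx0 : 0 < ‖x‖ := by linarith
  have key : ∀ y : Eu n, ‖y‖ = t →
      max (1 - ‖x‖ - inner ℝ (outward x) y) 0 ^ s - ballDist (x + y) ^ s ≤
        errorMajorant s (1 - ‖x‖) t := by
    intro y hy
    have h1 := le_ballDist_add hx y
    have h2 := sub_le_ballDist_add x y
    have h3 := abs_le.1 (abs_inner_outward_le hx0 y)
    rw [hy] at h1 h2 h3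
    exact rpow_sub_rpow_le_errorMajorant hs hs1 (by linarith) (by linarith) ht (ballDist_nonneg _)
      (le_max_right _ _) h1 h2 (max_le (by linarith [h3.1]) (by linarith))
  have hn : ‖t • θ‖ = t := by rw [norm_smul, hθ, mul_one, Real.norm_eq_abs, abs_of_pos ht]
  have k1 := key (t • θ) hn
  have k2 := key (-(t • θ)) (by rw [norm_neg, hn])
  rw [inner_neg_right] at k2
  rw [real_inner_smul_right] at k1 k2
  rw [← sub_eq_add_neg, sub_neg_eq_add] at k2
  simp only [secondDiff, halfSpaceDiff, ballDist_of_lt hx1]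
  linarith

lemma rayIntegral_le_zero {n : ℕ} {s : ℝ} (hs : 0 < s) (hs1 : s < 1)
    {x : Eu n} (hx : 1 / 2 ≤ ‖x‖) (hx1 : ‖x‖ < 1) {θ : Eu n} (hθ : ‖θ‖ = 1) :
    rayIntegral s s x θ ≤ 0 := by
  have hδ : 0 < 1 - ‖x‖ := by linarith
  rw [← integral_halfSpaceDiff (b := inner ℝ (outward x) θ) hs hs1 hδ]
  refine setIntegral_mono_on (integrableOn_ray hs hs1 hs (by linarith) hx hx1 hθ)
    (integrableOn_halfSpaceDiff hs hs1 hδ) measurableSet_Ioi fun t ht => ?_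
  have ht0 : (0 : ℝ) < t := ht
  exact mul_le_mul_of_nonneg_right
    (secondDiff_ballDist_rpow_le_halfSpaceDiff hs hx hx1 θ t) (by positivity)

/-- A bound for `(1 - s) * rayIntegral s s x θ` at distance `δ` from the sphere. -/
def rayBound (s δ : ℝ) : ℝ :=
  2 * (4 + 8 * ((1 - s) * (Real.log 2 + |Real.log δ|)) + 2 / s)

lemma neg_rayBound_le_rayIntegral {n : ℕ} {s : ℝ} (hs : 0 < s) (hs1 : s < 1)
    {x : Eu n} (hx : 1 / 2 ≤ ‖x‖) (hx1 : ‖x‖ < 1) {θ : Eu n} (hθ : ‖θ‖ = 1) :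
    -rayBound s (1 - ‖x‖) ≤ (1 - s) * rayIntegral s s x θ := by
  have hδ : 0 < 1 - ‖x‖ := by linarith
  obtain ⟨hM, hMle⟩ := errorMajorant_integral_le hs hs1 hδ (by linarith)
  have hH := integrableOn_halfSpaceDiff (b := inner ℝ (outward x) θ) hs hs1 hδ
  have h : (∫ t in Ioi (0 : ℝ), (halfSpaceDiff s (1 - ‖x‖) (inner ℝ (outward x) θ) t *
      t ^ (-1 - 2 * s) - 2 * (errorMajorant s (1 - ‖x‖) t * t ^ (-1 - 2 * s)))) ≤
      rayIntegral s s x θ := by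
    refine setIntegral_mono_on (hH.sub (hM.const_mul 2))
      (integrableOn_ray hs hs1 hs (by linarith) hx hx1 hθ) measurableSet_Ioi fun t ht => ?_
    have ht0 : (0 : ℝ) < t := ht
    have := mul_le_mul_of_nonneg_right
      (halfSpaceDiff_le_secondDiff_ballDist_rpow hs hs1 hx hx1 hθ ht0)
      (by positivity : 0 ≤ t ^ (-1 - 2 * s))
    linarith
  rw [integral_sub hH (hM.const_mul 2), integral_halfSpaceDiff hs hs1 hδ, integral_const_mul] at h
  have := mul_le_mul_of_nonneg_left h (by linarith : 0 ≤ 1 - s)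
  unfold rayBound
  linarith

lemma rpow_three_halves_sub_le {s a d : ℝ} (ha : 0 ≤ a) (hd : 0 < d) :
    3 / 2 * d ^ (s / 2) * (a ^ s - d ^ s) ≤ a ^ (3 * s / 2) - d ^ (3 * s / 2) := by
  have e : ∀ r : ℝ, 0 ≤ r → r ^ s = (r ^ (s / 2)) ^ 2 ∧ r ^ (3 * s / 2) = (r ^ (s / 2)) ^ 3 := by
    intro r hr
    rw [← Real.rpow_mul_natCast hr, ← Real.rpow_mul_natCast hr]
    constructor <;> congr 1 <;> push_cast <;> ring
  rw [(e a ha).1, (e a ha).2, (e d hd.le).1, (e d hd.le).2]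
  have h1 := Real.rpow_nonneg ha (s / 2)
  have h2 := Real.rpow_nonneg hd.le (s / 2)
  nlinarith [mul_nonneg (sq_nonneg (a ^ (s / 2) - d ^ (s / 2)))
    (by linarith : 0 ≤ a ^ (s / 2) + d ^ (s / 2) / 2)]

lemma rpow_three_halves_sub_add_le {s a d τ : ℝ} (hs : 0 < s) (hs1 : s < 1) (ha : 0 ≤ a)
    (hd : 0 < d) (hτ : 0 ≤ τ) (hτ1 : τ ≤ 1) (had : a ≤ d * (1 - τ)) :
    3 / 2 * d ^ (s / 2) * (a ^ s - d ^ s) + d ^ (3 * s / 2) * (s ^ 2 / 8 * τ ^ 2) ≤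
      a ^ (3 * s / 2) - d ^ (3 * s / 2) := by
  have e : ∀ r : ℝ, 0 ≤ r → r ^ s = (r ^ (s / 2)) ^ 2 ∧ r ^ (3 * s / 2) = (r ^ (s / 2)) ^ 3 := by
    intro r hr
    rw [← Real.rpow_mul_natCast hr, ← Real.rpow_mul_natCast hr]
    constructor <;> congr 1 <;> push_cast <;> ring
  have hA : a ^ (s / 2) ≤ d ^ (s / 2) * (1 - s / 2 * τ) := by
    calc a ^ (s / 2) ≤ (d * (1 - τ)) ^ (s / 2) := Real.rpow_le_rpow ha had (by linarith)
      _ = d ^ (s / 2) * (1 + -τ) ^ (s / 2) := by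
        rw [Real.mul_rpow hd.le (by linarith), sub_eq_add_neg]
      _ ≤ d ^ (s / 2) * (1 + s / 2 * -τ) := by
        gcongr
        exact rpow_one_add_le_one_add_mul_self (by linarith) (by linarith) (by linarith)
      _ = _ := by ring
  rw [(e a ha).1, (e a ha).2, (e d hd.le).1, (e d hd.le).2]
  have h1 := Real.rpow_nonneg ha (s / 2)
  have h2 := Real.rpow_nonneg hd.le (s / 2)
  generalize a ^ (s / 2) = A at *
  generalize d ^ (s / 2) = D at *
  have h3 : (D * (s / 2 * τ)) ^ 2 ≤ (D - A) ^ 2 := by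
    apply pow_le_pow_left₀ (by positivity)
    linarith
  nlinarith [mul_le_mul h3 (by linarith : D / 2 ≤ A + D / 2) (by linarith) (sq_nonneg _)]

lemma le_secondDiff_ballDist_rpow_three_halves {n : ℕ} {s : ℝ}
    {x : Eu n} (hx1 : ‖x‖ < 1) (y : Eu n) :
    3 / 2 * (1 - ‖x‖) ^ (s / 2) * secondDiff (fun z => ballDist z ^ s) x y ≤
      secondDiff (fun z => ballDist z ^ (3 * s / 2)) x y := by
  have hδ : 0 < 1 - ‖x‖ := by linarith
  simp only [secondDiff, ballDist_of_lt hx1]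
  have h1 := rpow_three_halves_sub_le (s := s) (ballDist_nonneg (x + y)) hδ
  have h2 := rpow_three_halves_sub_le (s := s) (ballDist_nonneg (x - y)) hδ
  linarith

lemma add_le_secondDiff_ballDist_rpow_three_halves {n : ℕ} {s : ℝ} (hs : 0 < s) (hs1 : s < 1)
    {x : Eu n} (hx : 1 / 2 ≤ ‖x‖) (hx1 : ‖x‖ < 1) (y : Eu n) (hy : ‖y‖ ≤ 1 - ‖x‖) :
    3 / 2 * (1 - ‖x‖) ^ (s / 2) * secondDiff (fun z => ballDist z ^ s) x y +
      (1 - ‖x‖) ^ (3 * s / 2) * (s ^ 2 / 8 * (inner ℝ (outward x) y / (1 - ‖x‖)) ^ 2) ≤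
      secondDiff (fun z => ballDist z ^ (3 * s / 2)) x y := by
  have hδ : 0 < 1 - ‖x‖ := by linarith
  have hx0 : 0 < ‖x‖ := by linarith
  wlog hb : 0 ≤ inner ℝ (outward x) y generalizing y
  · have := this (-y) (by rwa [norm_neg]) (by rw [inner_neg_right]; linarith)
    rw [inner_neg_right, neg_div, neg_sq] at this
    have e : ∀ u : Eu n → ℝ, secondDiff u x (-y) = secondDiff u x y := by
      intro u
      unfold secondDiff
      rw [sub_neg_eq_add, ← sub_eq_add_neg]
      ring
    rwa [e, e] at this
  have hb1 : inner ℝ (outward x) y ≤ 1 - ‖x‖ :=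
    ((le_abs_self _).trans (abs_inner_outward_le hx0 y)).trans hy
  have h0 := ballDist_add_le hx0 y
  rw [max_eq_left (by linarith)] at h0
  simp only [secondDiff, ballDist_of_lt hx1]
  have h1 := rpow_three_halves_sub_add_le (τ := inner ℝ (outward x) y / (1 - ‖x‖)) hs hs1
    (ballDist_nonneg (x + y)) hδ (by positivity) ((div_le_one hδ).2 hb1)
    (h0.trans_eq (by field_simp))
  have h2 := rpow_three_halves_sub_le (s := s) (ballDist_nonneg (x - y)) hδ
  linarith

lemma le_rayIntegral_three_halves {n : ℕ} {s : ℝ} (hs : 0 < s) (hs1 : s < 1)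
    {x : Eu n} (hx : 1 / 2 ≤ ‖x‖) (hx1 : ‖x‖ < 1) {θ : Eu n} (hθ : ‖θ‖ = 1) :
    -(3 / 2 * ((1 - ‖x‖) ^ (s / 2) * rayBound s (1 - ‖x‖))) +
      s ^ 2 / 16 * (1 - ‖x‖) ^ (-(s / 2)) * inner ℝ (outward x) θ ^ 2 ≤
      (1 - s) * rayIntegral s (3 * s / 2) x θ := by
  have hδ : 0 < 1 - ‖x‖ := by linarith
  set δ := 1 - ‖x‖ with hδdef
  set b := inner ℝ (outward x) θ with hb
  have hi1 := integrableOn_ray hs hs1 hs (by linarith) hx hx1 hθ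
  have hi2 := integrableOn_ray hs hs1 (β := 3 * s / 2) (by linarith) (by linarith) hx hx1 hθ
  set K := δ ^ (3 * s / 2) * (s ^ 2 / 8 * (b / δ) ^ 2) with hK
  have hq : IntegrableOn (fun t : ℝ => t ^ (1 - 2 * s)) (Ioc 0 δ) :=
    ((intervalIntegral.intervalIntegrable_rpow' (by linarith)).1)
  have hqi : ∫ t in Ioc 0 δ, t ^ (1 - 2 * s) = δ ^ (2 - 2 * s) / (2 - 2 * s) := by
    rw [← intervalIntegral.integral_of_le hδ.le, integral_rpow (Or.inl (by linarith)),
      Real.zero_rpow (by linarith)]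
    rw [show 1 - 2 * s + 1 = 2 - 2 * s by ring, sub_zero]
  have hind : IntegrableOn ((Ioc 0 δ).indicator fun t : ℝ => t ^ (1 - 2 * s)) (Ioi 0) :=
    ((integrable_indicator_iff measurableSet_Ioc).2 hq).integrableOn
  have hindi : ∫ t in Ioi (0 : ℝ), (Ioc 0 δ).indicator (fun t : ℝ => t ^ (1 - 2 * s)) t =
      δ ^ (2 - 2 * s) / (2 - 2 * s) := by
    rw [setIntegral_indicator measurableSet_Ioc, inter_eq_self_of_subset_right Ioc_subset_Ioi_self,
      hqi]
  have h : (∫ t in Ioi (0 : ℝ), (3 / 2 * δ ^ (s / 2) * (secondDiff (fun z => ballDist z ^ s) x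
      (t • θ) * t ^ (-1 - 2 * s)) + K * (Ioc 0 δ).indicator (fun t : ℝ => t ^ (1 - 2 * s)) t)) ≤
      rayIntegral s (3 * s / 2) x θ := by
    refine setIntegral_mono_on ((hi1.const_mul _).add (hind.const_mul K)) hi2 measurableSet_Ioi
      fun t ht => ?_
    have ht0 : (0 : ℝ) < t := ht
    have hw : 0 ≤ t ^ (-1 - 2 * s) := by positivity
    by_cases htδ : t ≤ δ
    · rw [indicator_of_mem (show t ∈ Ioc 0 δ from ⟨ht0, htδ⟩)]
      have hn : ‖t • θ‖ = t := by rw [norm_smul, hθ, mul_one, Real.norm_eq_abs, abs_of_pos ht0]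
      have := mul_le_mul_of_nonneg_right (add_le_secondDiff_ballDist_rpow_three_halves hs hs1 hx hx1
        (t • θ) (by rwa [hn])) hw
      rw [real_inner_smul_right, ← hb, ← hδdef] at this
      have e : t ^ (1 - 2 * s) = t ^ 2 * t ^ (-1 - 2 * s) := by
        rw [← Real.rpow_natCast, ← Real.rpow_add ht0]; congr 1; push_cast; ring
      rw [e, hK]
      refine le_trans (le_of_eq ?_) this
      ring
    · rw [indicator_of_notMem (fun h => htδ h.2)]
      have := mul_le_mul_of_nonneg_right (le_secondDiff_ballDist_rpow_three_halves (s := s) hx1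
        (t • θ)) hw
      rw [← hδdef] at this
      linarith
  rw [integral_add (hi1.const_mul _) (hind.const_mul K), integral_const_mul, integral_const_mul,
    hindi] at h
  change 3 / 2 * δ ^ (s / 2) * rayIntegral s s x θ + _ ≤ _ at h
  have hG := mul_le_mul_of_nonneg_left (neg_rayBound_le_rayIntegral hs hs1 hx hx1 hθ)
    (by positivity : 0 ≤ 3 / 2 * δ ^ (s / 2))
  rw [← hδdef] at hG
  have h' := mul_le_mul_of_nonneg_left h (by linarith : 0 ≤ 1 - s)
  have eK : (1 - s) * (K * (δ ^ (2 - 2 * s) / (2 - 2 * s))) =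
      s ^ 2 / 16 * δ ^ (-(s / 2)) * b ^ 2 := by
    have e : δ ^ (-(s / 2)) = δ ^ (3 * s / 2) * δ ^ (2 - 2 * s) * (δ ^ 2)⁻¹ := by
      rw [← Real.rpow_natCast, ← Real.rpow_neg hδ.le, ← Real.rpow_add hδ, ← Real.rpow_add hδ]
      congr 1; push_cast; ring
    have : 1 - s ≠ 0 := by linarith
    rw [hK, e, show 2 - 2 * s = 2 * (1 - s) by ring]
    field_simp
    ring
  linarith

lemma pow_sub_one_mul_div_rpow {n : ℕ} (hn : 1 ≤ n) {s t : ℝ} (ht : 0 < t) {a : ℝ} :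
    t ^ (n - 1) * (a / t ^ ((n : ℝ) + 2 * s)) = a * t ^ (-1 - 2 * s) := by
  have e : t ^ (-1 - 2 * s) = t ^ (n - 1) * (t ^ ((n : ℝ) + 2 * s))⁻¹ := by
    rw [← Real.rpow_neg ht.le, ← Real.rpow_natCast, ← Real.rpow_add ht, Nat.cast_sub hn]
    congr 1; push_cast; ring
  rw [e]
  ring

lemma integral_volumeIoiPow (m : ℕ) (f : ℝ → ℝ) :
    ∫ r : Ioi (0 : ℝ), f r ∂Measure.volumeIoiPow m = ∫ t in Ioi (0 : ℝ), t ^ m * f t := by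
  simp only [Measure.volumeIoiPow, ENNReal.ofReal]
  rw [integral_withDensity_eq_integral_smul,
    integral_subtype_comap measurableSet_Ioi fun a ↦ Real.toNNReal (a ^ m) • f a]
  · refine setIntegral_congr_fun measurableSet_Ioi fun t ht => ?_
    rw [NNReal.smul_def, Real.coe_toNNReal _ (pow_nonneg ht.out.le _), smul_eq_mul]
  · exact (measurable_subtype_coe.pow_const _).real_toNNReal

/-- Integration in polar coordinates. -/
lemma integral_polar {n : ℕ} (hn : 1 ≤ n) {f : Eu n → ℝ} (hf : Integrable f) :
    Integrable (fun θ : sphere (0 : Eu n) 1 => ∫ t in Ioi (0 : ℝ), t ^ (n - 1) * f (t • (θ : Eu n)))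
      (volume : Measure (Eu n)).toSphere ∧
    ∫ y, f y = ∫ θ : sphere (0 : Eu n) 1, (∫ t in Ioi (0 : ℝ), t ^ (n - 1) * f (t • (θ : Eu n)))
      ∂(volume : Measure (Eu n)).toSphere := by
  have := nontrivial_Eu hn
  have hmp := (volume : Measure (Eu n)).measurePreserving_homeomorphUnitSphereProd
  rw [finrank_euclideanSpace_fin] at hmp
  have hemb := (homeomorphUnitSphereProd (Eu n)).measurableEmbedding
  set g : sphere (0 : Eu n) 1 × Ioi (0 : ℝ) → ℝ := fun p => f ((p.2 : ℝ) • (p.1 : Eu n)) with hg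
  have hgφ : g ∘ homeomorphUnitSphereProd (Eu n) =
      f ∘ (Subtype.val : ({0}ᶜ : Set (Eu n)) → Eu n) := by
    funext z
    have hz : ‖(z : Eu n)‖ ≠ 0 := norm_ne_zero_iff.2 z.2
    simp [hg, smul_smul, mul_inv_cancel₀ hz]
  have hgi : Integrable g
      ((volume : Measure (Eu n)).toSphere.prod (Measure.volumeIoiPow (n - 1))) := by
    rw [← hmp.integrable_comp_emb hemb, hgφ,
      ← integrableOn_iff_comap_subtypeVal (measurableSet_singleton _).compl]
    exact hf.integrableOn
  have e : ∀ θ : sphere (0 : Eu n) 1, ∫ r : Ioi (0 : ℝ), g (θ, r) ∂Measure.volumeIoiPow (n - 1) =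
      ∫ t in Ioi (0 : ℝ), t ^ (n - 1) * f (t • (θ : Eu n)) := fun θ =>
    integral_volumeIoiPow (n - 1) fun t => f (t • (θ : Eu n))
  constructor
  · simpa only [e] using hgi.integral_prod_left
  · calc ∫ y, f y = ∫ z : ({0}ᶜ : Set (Eu n)), f z ∂((volume : Measure (Eu n)).comap (↑)) := by
          rw [integral_subtype_comap (measurableSet_singleton _).compl f, restrict_compl_singleton]
      _ = ∫ p, g p ∂((volume : Measure (Eu n)).toSphere.prod (Measure.volumeIoiPow (n - 1))) := by
          rw [← hmp.integral_comp hemb g]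
          exact congrArg (fun h => ∫ z, h z ∂((volume : Measure (Eu n)).comap Subtype.val)) hgφ.symm
      _ = _ := by
          rw [integral_prod _ hgi]
          simp only [e]

lemma integrable_min_sq_one_div_rpow {n : ℕ} (hn : 1 ≤ n) {s : ℝ} (hs : 0 < s) (hs1 : s < 1) :
    Integrable (fun y : Eu n => min (‖y‖ ^ 2) 1 / ‖y‖ ^ ((n : ℝ) + 2 * s)) := by
  have := nontrivial_Eu hn
  refine (integrable_fun_norm_addHaar (volume : Measure (Eu n))
    (f := fun r : ℝ => min (r ^ 2) 1 / r ^ ((n : ℝ) + 2 * s))).2 ?_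
  rw [finrank_euclideanSpace_fin]
  have h : IntegrableOn (fun t : ℝ => min (t ^ 2) 1 * t ^ (-1 - 2 * s)) (Ioi 0) := by
    refine integrableOn_mul_rpow_of_le (A := 1) (κ := 0) hs1 (by linarith) (by fun_prop) ?_ ?_
    · intro t _
      rw [abs_of_nonneg (by positivity), one_mul]
      exact min_le_left _ _
    · intro t _
      rw [abs_of_nonneg (by positivity), one_mul, Real.rpow_zero]
      exact min_le_right _ _
  refine h.congr_fun (fun t ht => ?_) measurableSet_Ioi
  have ht0 : (0 : ℝ) < t := ht
  exact (pow_sub_one_mul_div_rpow hn ht0).symm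

lemma integrable_kernIntegrand_ballDist {n : ℕ} (hn : 1 ≤ n) {s β lam Lam : ℝ} (hs : 0 < s)
    (hs1 : s < 1) (hβ : 0 < β) (hβ2 : β ≤ 2) (hlam : 0 < lam) {x : Eu n} (hx : 1 / 2 ≤ ‖x‖)
    (hx1 : ‖x‖ < 1) {μ : Eu n → ℝ} (hμ : IsAdmissibleKernel n lam Lam μ) :
    Integrable (kernIntegrand n s μ (fun z => ballDist z ^ β) x) := by
  have := nontrivial_Eu hn
  have hδ : 0 < 1 - ‖x‖ := by linarith
  set A := 2 + (2 / (1 - ‖x‖) ^ 2 + 64 / (1 - ‖x‖)) with hA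
  have hA0 : 0 ≤ 2 / (1 - ‖x‖) ^ 2 + 64 / (1 - ‖x‖) := by positivity
  have hm : AEStronglyMeasurable (kernIntegrand n s μ (fun z => ballDist z ^ β) x) := by
    refine Measurable.aestronglyMeasurable ?_
    have h1 := (continuous_secondDiff_ballDist_rpow hβ.le x).measurable
    have h2 : Measurable fun y : Eu n => μ (‖y‖⁻¹ • y) :=
      hμ.1.comp (measurable_norm.inv.smul measurable_id)
    have h3 : Measurable fun y : Eu n => ‖y‖ ^ ((n : ℝ) + 2 * s) :=
      measurable_norm.pow_const _
    exact (h1.mul h2).div h3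
  refine ((integrable_min_sq_one_div_rpow hn hs hs1).const_mul (A * Lam)).mono' hm ?_
  filter_upwards [compl_mem_ae_iff.2 (measure_singleton (0 : Eu n))] with y hy
  have hy0 : y ≠ 0 := hy
  have hθ := norm_smul_inv_norm (𝕜 := ℝ) hy0
  have hμy := hμ.2.1 (‖y‖⁻¹ • y) (by simpa using hθ)
  have hb : |secondDiff (fun z => ballDist z ^ β) x y| ≤ A * min (‖y‖ ^ 2) 1 := by
    have h1 := abs_secondDiff_ballDist_rpow_le_two hβ.le x y
    have h2 := abs_secondDiff_ballDist_rpow_le_sq hβ hβ2 hx hx1 y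
    rw [mul_min_of_nonneg _ _ (by positivity)]
    refine le_min ?_ (by linarith)
    nlinarith [sq_nonneg ‖y‖]
  change ‖secondDiff (fun z => ballDist z ^ β) x y * μ (‖y‖⁻¹ • y) / ‖y‖ ^ ((n : ℝ) + 2 * s)‖ ≤ _
  have hp : 0 ≤ ‖y‖ ^ ((n : ℝ) + 2 * s) := by positivity
  rw [Real.norm_eq_abs, abs_div, abs_mul, abs_of_nonneg hp,
    abs_of_nonneg (hlam.le.trans hμy.1), ← mul_div_assoc]
  refine div_le_div_of_nonneg_right ?_ hp
  calc _ ≤ A * min (‖y‖ ^ 2) 1 * Lam :=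
        mul_le_mul hb hμy.2 (hlam.le.trans hμy.1) (by positivity)
    _ = _ := by ring

lemma Lop_ballDist_eq {n : ℕ} (hn : 1 ≤ n) {s β lam Lam : ℝ} (hs : 0 < s)
    (hs1 : s < 1) (hβ : 0 < β) (hβ2 : β ≤ 2) (hlam : 0 < lam) {x : Eu n} (hx : 1 / 2 ≤ ‖x‖)
    (hx1 : ‖x‖ < 1) {μ : Eu n → ℝ} (hμ : IsAdmissibleKernel n lam Lam μ) :
    Integrable (fun θ : sphere (0 : Eu n) 1 => μ θ * ((1 - s) * rayIntegral s β x θ))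
      (volume : Measure (Eu n)).toSphere ∧
    Lop n s μ (fun z => ballDist z ^ β) x =
      ∫ θ : sphere (0 : Eu n) 1, μ θ * ((1 - s) * rayIntegral s β x θ)
        ∂(volume : Measure (Eu n)).toSphere := by
  have hi := integral_polar hn (integrable_kernIntegrand_ballDist hn hs hs1 hβ hβ2 hlam hx hx1 hμ)
  have e : ∀ θ : sphere (0 : Eu n) 1, (1 - s) * ∫ t in Ioi (0 : ℝ), t ^ (n - 1) *
      kernIntegrand n s μ (fun z => ballDist z ^ β) x (t • (θ : Eu n)) =
      μ θ * ((1 - s) * rayIntegral s β x θ) := by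
    intro θ
    have hθ : ‖(θ : Eu n)‖ = 1 := norm_eq_of_mem_sphere θ
    rw [mul_left_comm (μ θ), rayIntegral, ← integral_const_mul (μ θ)]
    congr 1
    refine setIntegral_congr_fun measurableSet_Ioi fun t ht => ?_
    have ht0 : (0 : ℝ) < t := ht
    have hn' : ‖t • (θ : Eu n)‖ = t := by
      rw [norm_smul, hθ, mul_one, Real.norm_eq_abs, abs_of_pos ht0]
    change t ^ (n - 1) * (secondDiff (fun z => ballDist z ^ β) x (t • (θ : Eu n)) *
      μ (‖t • (θ : Eu n)‖⁻¹ • t • (θ : Eu n)) / ‖t • (θ : Eu n)‖ ^ ((n : ℝ) + 2 * s)) = _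
    rw [hn', inv_smul_smul₀ ht0.ne', pow_sub_one_mul_div_rpow hn ht0]
    ring
  constructor
  · simpa only [e] using hi.1.const_mul (1 - s)
  · rw [Lop, hi.2, ← integral_const_mul]
    simp only [e]

lemma rayBound_nonneg {s δ : ℝ} (hs : 0 < s) (hs1 : s < 1) : 0 ≤ rayBound s δ := by
  have h1 : 0 ≤ 1 - s := by linarith
  have h2 : 0 ≤ Real.log 2 := Real.log_nonneg (by norm_num)
  unfold rayBound
  positivity

lemma rayBound_le {s₀ s δ : ℝ} (hs₀ : 0 < s₀) (hs : s₀ ≤ s) (hs1 : s < 1) :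
    rayBound s δ ≤ (24 + 4 / s₀) * (1 + (1 - s) * |Real.log δ|) := by
  have h1 : 0 ≤ 1 - s := by linarith
  have h2 : Real.log 2 ≤ 1 := by linarith [Real.log_two_lt_d9]
  have h3 : 2 / s ≤ 2 / s₀ := div_le_div_of_nonneg_left (by norm_num) hs₀ hs
  have h4 : 0 ≤ 4 / s₀ := by positivity
  have h5 : 0 ≤ (1 - s) * |Real.log δ| := by positivity
  have h6 : (1 - s) * Real.log 2 ≤ 1 := by
    nlinarith [Real.log_nonneg (by norm_num : (1 : ℝ) ≤ 2)]
  have h7 : 4 / s₀ = 2 * (2 / s₀) := by ring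
  unfold rayBound
  nlinarith [mul_nonneg h4 h5]

lemma rpow_half_mul_rayBound_le {s₀ s δ : ℝ} (hs₀ : 0 < s₀) (hs : s₀ ≤ s) (hs1 : s < 1)
    (hδ : 0 < δ) (hδ1 : δ ≤ 1) :
    δ ^ (s / 2) * rayBound s δ ≤ (24 + 4 / s₀) * (1 + 2 / s₀) := by
  have hs0 : 0 < s := by linarith
  have hp : 0 < δ ^ (s / 2) := by positivity
  have hp1 : δ ^ (s / 2) ≤ 1 := Real.rpow_le_one hδ.le hδ1 (by linarith)
  have hlog : δ ^ (s / 2) * |Real.log δ| ≤ 2 / s₀ := by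
    have h := Real.log_le_rpow_div (inv_nonneg.2 hδ.le) (by linarith : 0 < s / 2)
    rw [Real.log_inv, Real.inv_rpow hδ.le] at h
    rw [abs_of_nonpos (Real.log_nonpos hδ.le hδ1)]
    calc δ ^ (s / 2) * -Real.log δ ≤ δ ^ (s / 2) * ((δ ^ (s / 2))⁻¹ / (s / 2)) :=
          mul_le_mul_of_nonneg_left h hp.le
      _ = 2 / s := by field_simp
      _ ≤ 2 / s₀ := div_le_div_of_nonneg_left (by norm_num) hs₀ hs
  have h0 : 0 ≤ δ ^ (s / 2) * |Real.log δ| := by positivity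
  have h1 : (1 - s) * (δ ^ (s / 2) * |Real.log δ|) ≤ 2 / s₀ := by nlinarith
  calc δ ^ (s / 2) * rayBound s δ
      ≤ δ ^ (s / 2) * ((24 + 4 / s₀) * (1 + (1 - s) * |Real.log δ|)) :=
        mul_le_mul_of_nonneg_left (rayBound_le hs₀ hs hs1) hp.le
    _ = (24 + 4 / s₀) * (δ ^ (s / 2) + (1 - s) * (δ ^ (s / 2) * |Real.log δ|)) := by ring
    _ ≤ _ := by gcongr

/-- The surface area of the unit sphere. -/
def sphereArea (n : ℕ) : ℝ := (volume : Measure (Eu n)).toSphere.real univ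

/-- A lower bound for the surface area of the spherical caps of radius `1`. -/
def capBound (n : ℕ) : ℝ :=
  Measure.toSphereBallBound n 1 * (volume : Measure (Eu n)).real (ball 0 1)

lemma capBound_pos (n : ℕ) : 0 < capBound n := by
  refine mul_pos (NNReal.coe_pos.2 (Measure.toSphereBallBound_pos n 1)) ?_
  exact ENNReal.toReal_pos (measure_ball_pos _ _ one_pos).ne' measure_ball_lt_top.ne

lemma sphereArea_nonneg (n : ℕ) : 0 ≤ sphereArea n := measureReal_nonneg

lemma one_fourth_le_inner_sq {n : ℕ} {e θ : Eu n} (he : ‖e‖ = 1) (hθ : ‖θ‖ = 1)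
    (h : dist θ e < 1) : 1 / 4 ≤ inner ℝ e θ ^ 2 := by
  rw [dist_eq_norm] at h
  have h1 := norm_sub_sq_real θ e
  rw [he, hθ, real_inner_comm] at h1
  have h2 : ‖θ - e‖ ^ 2 < 1 := by nlinarith [norm_nonneg (θ - e)]
  nlinarith

section

variable {n : ℕ} {s lam Lam : ℝ} {x : Eu n} {μ : Eu n → ℝ}

lemma Lop_ballDist_rpow_le_zero (hn : 1 ≤ n) (hs : 0 < s) (hs1 : s < 1) (hlam : 0 < lam)
    (hx : 1 / 2 ≤ ‖x‖) (hx1 : ‖x‖ < 1) (hμ : IsAdmissibleKernel n lam Lam μ) :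
    Lop n s μ (fun z => ballDist z ^ s) x ≤ 0 := by
  rw [(Lop_ballDist_eq hn hs hs1 hs (by linarith) hlam hx hx1 hμ).2]
  refine integral_nonpos fun θ => ?_
  have hθ : ‖(θ : Eu n)‖ = 1 := norm_eq_of_mem_sphere θ
  exact mul_nonpos_of_nonneg_of_nonpos (hlam.le.trans (hμ.2.1 _ hθ).1)
    (mul_nonpos_of_nonneg_of_nonpos (by linarith) (rayIntegral_le_zero hs hs1 hx hx1 hθ))

lemma neg_le_Lop_ballDist_rpow (hn : 1 ≤ n) (hs : 0 < s) (hs1 : s < 1) (hlam : 0 < lam)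
    (hx : 1 / 2 ≤ ‖x‖) (hx1 : ‖x‖ < 1) (hμ : IsAdmissibleKernel n lam Lam μ) :
    -(Lam * sphereArea n * rayBound s (1 - ‖x‖)) ≤ Lop n s μ (fun z => ballDist z ^ s) x := by
  obtain ⟨hi, he⟩ := Lop_ballDist_eq hn hs hs1 hs (by linarith) hlam hx hx1 hμ
  rw [he]
  have h := integral_mono (μ := (volume : Measure (Eu n)).toSphere)
    (integrable_const (-(Lam * rayBound s (1 - ‖x‖)))) hi fun θ => ?_
  · rw [integral_const, smul_eq_mul] at h
    refine le_trans (le_of_eq ?_) h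
    rw [sphereArea]
    ring
  · have hθ : ‖(θ : Eu n)‖ = 1 := norm_eq_of_mem_sphere θ
    have hμθ := hμ.2.1 _ hθ
    have h1 := mul_le_mul_of_nonneg_left (neg_rayBound_le_rayIntegral hs hs1 hx hx1 hθ)
      (hlam.le.trans hμθ.1)
    have h2 := mul_le_mul_of_nonneg_right hμθ.2 (rayBound_nonneg (δ := 1 - ‖x‖) hs hs1)
    dsimp only
    linarith

lemma le_Lop_ballDist_rpow_three_halves (hn : 1 ≤ n) (hs : 0 < s) (hs1 : s < 1) (hlam : 0 < lam)
    (hx : 1 / 2 ≤ ‖x‖) (hx1 : ‖x‖ < 1) (hμ : IsAdmissibleKernel n lam Lam μ) :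
    -(3 / 2 * Lam * sphereArea n * ((1 - ‖x‖) ^ (s / 2) * rayBound s (1 - ‖x‖))) +
      lam * s ^ 2 / 64 * capBound n * (1 - ‖x‖) ^ (-(s / 2)) ≤
      Lop n s μ (fun z => ballDist z ^ (3 * s / 2)) x := by
  have := nontrivial_Eu hn
  have hδ : 0 < 1 - ‖x‖ := by linarith
  obtain ⟨hi, he⟩ := Lop_ballDist_eq hn hs hs1 (β := 3 * s / 2) (by linarith) (by linarith) hlam
    hx hx1 hμ
  rw [he]
  set e : sphere (0 : Eu n) 1 :=
    ⟨outward x, mem_sphere_zero_iff_norm.2 (norm_outward (by linarith))⟩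
  set R := (1 - ‖x‖) ^ (s / 2) * rayBound s (1 - ‖x‖) with hR
  have hR0 : 0 ≤ R := mul_nonneg (by positivity) (rayBound_nonneg hs hs1)
  set κ := lam * s ^ 2 / 64 * (1 - ‖x‖) ^ (-(s / 2)) with hκ
  have hκ0 : 0 ≤ κ := by positivity
  have hcap : capBound n ≤ (volume : Measure (Eu n)).toSphere.real (ball e 1) := by
    simpa [capBound] using
      Measure.toSphereBallBound_mul_measureReal_unitBall_le_toSphere_ball
        (volume : Measure (Eu n)) one_pos e
  have hic : Integrable ((ball e 1).indicator fun _ => κ) (volume : Measure (Eu n)).toSphere :=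
    (integrable_const κ).indicator measurableSet_ball
  have h := integral_mono (μ := (volume : Measure (Eu n)).toSphere)
    ((integrable_const (-(3 / 2 * Lam * R))).add hic) hi fun θ => ?_
  · simp only [Pi.add_apply] at h
    rw [integral_add (integrable_const _) hic, integral_const, smul_eq_mul,
      integral_indicator_const _ measurableSet_ball, smul_eq_mul] at h
    refine le_trans ?_ h
    have := mul_le_mul_of_nonneg_right hcap hκ0
    have hκN : lam * s ^ 2 / 64 * capBound n * (1 - ‖x‖) ^ (-(s / 2)) = capBound n * κ := by
      rw [hκ]; ring
    rw [sphereArea, hκN]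
    linarith
  · have hθ : ‖(θ : Eu n)‖ = 1 := norm_eq_of_mem_sphere θ
    have hμθ := hμ.2.1 _ hθ
    have h1 := mul_le_mul_of_nonneg_left (le_rayIntegral_three_halves hs hs1 hx hx1 hθ)
      (hlam.le.trans hμθ.1)
    have h2 := mul_le_mul_of_nonneg_right hμθ.2 hR0
    have hq : 0 ≤ s ^ 2 / 16 * (1 - ‖x‖) ^ (-(s / 2)) * inner ℝ (outward x) (θ : Eu n) ^ 2 := by
      positivity
    have h3 := mul_le_mul_of_nonneg_right hμθ.1 hq
    have h4 : (ball e 1).indicator (fun _ => κ) θ ≤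
        lam * (s ^ 2 / 16 * (1 - ‖x‖) ^ (-(s / 2)) * inner ℝ (outward x) (θ : Eu n) ^ 2) := by
      by_cases hb : θ ∈ ball e 1
      · rw [indicator_of_mem hb]
        have := one_fourth_le_inner_sq (norm_outward (x := x) (by linarith)) hθ hb
        calc κ = lam * (s ^ 2 / 16 * (1 - ‖x‖) ^ (-(s / 2)) * (1 / 4)) := by rw [hκ]; ring
          _ ≤ _ := by gcongr
      · rw [indicator_of_notMem hb]
        positivity
    simp only [Pi.add_apply]
    rw [← hR] at h1
    linarith

end

lemma nonempty_isAdmissibleKernel (n : ℕ) {lam Lam : ℝ} (h : lam ≤ Lam) :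
    Nonempty {μ : Eu n → ℝ // IsAdmissibleKernel n lam Lam μ} :=
  ⟨⟨fun _ => lam, measurable_const, fun _ _ => ⟨le_rfl, h⟩, fun _ => rfl⟩⟩

/-- Lemma 2.2 (barriers from Ros-Oton–Serra): pointwise bounds for `𝓜⁻` applied to
`ρ₁(x) = dist(x, ℝⁿ∖B₁)^s` and `ρ₂(x) = dist(x, ℝⁿ∖B₁)^{3s/2}` on `B₁∖B_{1/2}`, with
constants depending only on `n, s₀, λ, Λ`. -/
theorem stmt2 (n : ℕ) (hn : 1 ≤ n) (lam Lam : ℝ) (hlam : 0 < lam) (hlamLam : lam ≤ Lam)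
    (s₀ : ℝ) (hs₀ : s₀ ∈ Set.Ioo (0:ℝ) 1) :
    ∃ c > 0, ∃ C > 0, ∀ s ∈ Set.Ico s₀ 1,
      ∀ x ∈ Metric.ball (0 : Eu n) 1 \ Metric.ball (0 : Eu n) (1/2),
        (PucciInf n s lam Lam
            (fun z => Metric.infDist z (Metric.ball (0 : Eu n) 1)ᶜ ^ s) x ≤ 0) ∧
        (-(C * (1 + (1 - s) * |Real.log (1 - ‖x‖)|)) ≤
          PucciInf n s lam Lam
            (fun z => Metric.infDist z (Metric.ball (0 : Eu n) 1)ᶜ ^ s) x) ∧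
        (c * (1 - ‖x‖) ^ (-(s/2)) - C ≤
          PucciInf n s lam Lam
            (fun z => Metric.infDist z (Metric.ball (0 : Eu n) 1)ᶜ ^ (3 * s / 2)) x) := by
  have hs₀0 : 0 < s₀ := hs₀.1
  have hN := capBound_pos n
  have hS := sphereArea_nonneg n
  have hLam : 0 < Lam := hlam.trans_le hlamLam
  have hK : 0 < 24 + 4 / s₀ := by positivity
  have hD : 0 < 1 + 2 / s₀ := by positivity
  set C₁ := Lam * sphereArea n * (24 + 4 / s₀) with hC₁
  have hC₁0 : 0 ≤ C₁ := by positivity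
  set C₂ := 3 / 2 * C₁ * (1 + 2 / s₀) with hC₂
  have hC₂0 : 0 ≤ C₂ := by positivity
  refine ⟨lam * s₀ ^ 2 / 64 * capBound n, by positivity, C₁ + C₂ + 1, by positivity, ?_⟩
  rintro s ⟨hs, hs1⟩ x ⟨hx1, hx⟩
  have hx1 : ‖x‖ < 1 := by simpa using hx1
  have hx : 1 / 2 ≤ ‖x‖ := by simpa using hx
  have hδ : 0 < 1 - ‖x‖ := by linarith
  have hs0 : 0 < s := by linarith
  have hne := nonempty_isAdmissibleKernel n hlamLam
  simp only [infDist_compl_ball hn]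
  have hlow : ∀ μ : {μ : Eu n → ℝ // IsAdmissibleKernel n lam Lam μ},
      -((C₁ + C₂ + 1) * (1 + (1 - s) * |Real.log (1 - ‖x‖)|)) ≤
        Lop n s μ.1 (fun z => ballDist z ^ s) x := by
    intro μ
    refine le_trans (neg_le_neg ?_) (neg_le_Lop_ballDist_rpow hn hs0 hs1 hlam hx hx1 μ.2)
    have hl : 0 ≤ 1 + (1 - s) * |Real.log (1 - ‖x‖)| :=
      add_nonneg zero_le_one (mul_nonneg (by linarith) (abs_nonneg _))
    calc Lam * sphereArea n * rayBound s (1 - ‖x‖)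
        ≤ Lam * sphereArea n * ((24 + 4 / s₀) * (1 + (1 - s) * |Real.log (1 - ‖x‖)|)) :=
          mul_le_mul_of_nonneg_left (rayBound_le hs₀0 hs hs1) (by positivity)
      _ = C₁ * (1 + (1 - s) * |Real.log (1 - ‖x‖)|) := by rw [hC₁]; ring
      _ ≤ _ := mul_le_mul_of_nonneg_right (by linarith) hl
  refine ⟨?_, le_ciInf hlow, le_ciInf fun μ => ?_⟩
  · obtain ⟨μ⟩ := hne
    exact (ciInf_le ⟨_, forall_mem_range.2 hlow⟩ μ).trans
      (Lop_ballDist_rpow_le_zero hn hs0 hs1 hlam hx hx1 μ.2)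
  · refine le_trans ?_ (le_Lop_ballDist_rpow_three_halves hn hs0 hs1 hlam hx hx1 μ.2)
    have h1 := mul_le_mul_of_nonneg_left
      (rpow_half_mul_rayBound_le hs₀0 hs hs1 hδ (by linarith))
      (by positivity : 0 ≤ 3 / 2 * Lam * sphereArea n)
    have h2 : lam * s₀ ^ 2 / 64 * capBound n * (1 - ‖x‖) ^ (-(s / 2)) ≤
        lam * s ^ 2 / 64 * capBound n * (1 - ‖x‖) ^ (-(s / 2)) := by gcongr
    have h3 : 3 / 2 * Lam * sphereArea n * ((24 + 4 / s₀) * (1 + 2 / s₀)) = C₂ := by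
      rw [hC₂, hC₁]; ring
    linarith
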